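/- arXiv:2603.07722 — 6 statements merged into one kernel-verified Lean document; each statement's English description precedes it below -/
import Mathlib

section
/- Boundary characterization of the gap between the identified set and its moment closure (Lemma C.1, part ii). Suppose Assumption 1 holds, F ∈ 𝓕, θ ∈ Θ, and r₁(·;θ) is F-integrable. If θ ∈ Θ̄_I(F) but θ ∉ Θ_I(F), then ∫ r₁(z;θ) dF = 0 and inf_{λ ∈ 𝒮₂} ∫ γ₂(λ,z;θ) dF = 0; equivalently, inf_{λ ∈ 𝒮} ∫ γ(λ,z;θ) dF = 0. -/
open MeasureTheory Set
open scoped ENNReal RealInnerProductSpace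

noncomputable section

/-- The positive part of an extended real, as an extended nonnegative real. -/
def EReal.posPart (x : EReal) : ℝ≥0∞ := if x = ⊤ then ⊤ else ENNReal.ofReal x.toReal

/-- The integral of an `EReal`-valued function: the integral of its positive part
minus the integral of its negative part (an element of `EReal`). -/
def integralEReal {𝓩 : Type*} [MeasurableSpace 𝓩] (F : Measure 𝓩) (f : 𝓩 → EReal) : EReal :=
  ((∫⁻ z, (f z).posPart ∂F : ℝ≥0∞) : EReal) - ((∫⁻ z, (-(f z)).posPart ∂F : ℝ≥0∞) : EReal)

variable {𝓤 𝓩 : Type*}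
  [MeasurableSpace 𝓤] [TopologicalSpace 𝓤] [PolishSpace 𝓤] [BorelSpace 𝓤]
  [MeasurableSpace 𝓩] [TopologicalSpace 𝓩] [PolishSpace 𝓩] [BorelSpace 𝓩]
  {Θ : Type*}

/-- The section `Γ(z;θ) = {u : (u,z) ∈ Γ(θ)}`. -/
def sectionSet (Γθ : Set (𝓤 × 𝓩)) (z : 𝓩) : Set 𝓤 := {u | (u, z) ∈ Γθ}

/-- The set `𝓡(z;θ)` of moment values consistent with the support restriction at `z`. -/
def momentSet {d : ℕ} (Γθ : Set (𝓤 × 𝓩)) (rθ : 𝓤 → 𝓩 → EuclideanSpace ℝ (Fin d)) (z : 𝓩) :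
    Set (EuclideanSpace ℝ (Fin d)) := (fun u => rθ u z) '' sectionSet Γθ z

/-- The support function `γ(λ,z;θ) = sup {λᵀt : t ∈ 𝓡(z;θ)}`, with values in `EReal`. -/
def suppFun {d : ℕ} (Γθ : Set (𝓤 × 𝓩)) (rθ : 𝓤 → 𝓩 → EuclideanSpace ℝ (Fin d))
    (l : EuclideanSpace ℝ (Fin d)) (z : 𝓩) : EReal :=
  sSup ((fun t => ((⟪l, t⟫ : ℝ) : EReal)) '' momentSet Γθ rθ z)

/-- Assumption 1 at a single parameter value and a single distribution. -/
structure Assumption1At {d : ℕ} (F : Measure 𝓩) (Γθ : Set (𝓤 × 𝓩))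
    (rθ : 𝓤 → 𝓩 → EuclideanSpace ℝ (Fin d)) : Prop where
  borel_Gamma : MeasurableSet Γθ
  nonempty_section : ∀ z, (sectionSet Γθ z).Nonempty
  borel_section : ∀ z, MeasurableSet (sectionSet Γθ z)
  measurable_r : Measurable fun p : 𝓤 × 𝓩 => rθ p.1 p.2
  lower_envelope : ∃ g : 𝓩 → ℝ, Measurable g ∧ Integrable g F ∧
    ∀ᵐ z ∂F, sInf (norm '' momentSet Γθ rθ z) ≤ g z

/-- Assumption 1: measurability, nonempty sections, and an integrable lower envelope for
the infimum of the norm over the moment set. -/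
def Assumption1 {d : ℕ} (𝓕 : Set (Measure 𝓩)) (Γ : Θ → Set (𝓤 × 𝓩))
    (r : Θ → 𝓤 → 𝓩 → EuclideanSpace ℝ (Fin d)) : Prop :=
  ∀ θ : Θ, ∀ F ∈ 𝓕, Assumption1At F (Γ θ) (r θ)

/-- Assumption 2 at a single parameter value and distribution: closedness and
integrable boundedness of the moment sets. -/
structure Assumption2At {d : ℕ} (F : Measure 𝓩) (Γθ : Set (𝓤 × 𝓩))
    (rθ : 𝓤 → 𝓩 → EuclideanSpace ℝ (Fin d)) : Prop where
  closed_momentSet : ∀ᵐ z ∂F, IsClosed (momentSet Γθ rθ z)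
  upper_envelope : ∃ g : 𝓩 → ℝ, Measurable g ∧ Integrable g F ∧
    ∀ᵐ z ∂F, ∀ t ∈ momentSet Γθ rθ z, ‖t‖ ≤ g z

/-- Assumption 2 (closedness and integrable boundedness). -/
def Assumption2 {d : ℕ} (𝓕 : Set (Measure 𝓩)) (Γ : Θ → Set (𝓤 × 𝓩))
    (r : Θ → 𝓤 → 𝓩 → EuclideanSpace ℝ (Fin d)) : Prop :=
  ∀ θ : Θ, ∀ F ∈ 𝓕, Assumption2At F (Γ θ) (r θ)

/-- `θ` belongs to the identified set `Θ_I(F)`: there is a Borel probability measure `H`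
on `𝓤 × 𝓩` giving probability one to the support restriction, with `𝓩`-marginal `F`,
under which the moment function is integrable with mean zero. -/
def MemIdentified {d : ℕ} (Γθ : Set (𝓤 × 𝓩)) (rθ : 𝓤 → 𝓩 → EuclideanSpace ℝ (Fin d))
    (F : Measure 𝓩) : Prop :=
  ∃ H : Measure (𝓤 × 𝓩), IsProbabilityMeasure H ∧ H Γθ = 1 ∧ H.map Prod.snd = F ∧
    Integrable (fun p : 𝓤 × 𝓩 => rθ p.1 p.2) H ∧ (∫ p : 𝓤 × 𝓩, rθ p.1 p.2 ∂H) = 0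

/-- `θ` belongs to the moment closure `Θ̄_I(F)` of the identified set. -/
def MemMomentClosure {d : ℕ} (Γθ : Set (𝓤 × 𝓩)) (rθ : 𝓤 → 𝓩 → EuclideanSpace ℝ (Fin d))
    (F : Measure 𝓩) : Prop :=
  ∀ ε : ℝ, 0 < ε → ∃ H : Measure (𝓤 × 𝓩), IsProbabilityMeasure H ∧ H Γθ = 1 ∧
    H.map Prod.snd = F ∧ Integrable (fun p : 𝓤 × 𝓩 => rθ p.1 p.2) H ∧
    ‖∫ p : 𝓤 × 𝓩, rθ p.1 p.2 ∂H‖ ≤ ε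

/-- `θ` belongs to the support-function set `Θ̃(F)`:
`∫ γ(λ,z;θ) dF ≥ 0` for every `λ` in the unit sphere. -/
def MemSFSet {d : ℕ} (Γθ : Set (𝓤 × 𝓩)) (rθ : 𝓤 → 𝓩 → EuclideanSpace ℝ (Fin d))
    (F : Measure 𝓩) : Prop :=
  ∀ l : EuclideanSpace ℝ (Fin d), ‖l‖ = 1 → (0 : EReal) ≤ integralEReal F (suppFun Γθ rθ l)


/-- The combined moment function `r(u,z;θ) = (r₁(z;θ), r₂(u,z;θ))`, where `r₁` collects the
components that do not depend on the latent variable `u`. -/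
def rComb {d1 d2 : ℕ} (r1θ : 𝓩 → EuclideanSpace ℝ (Fin d1))
    (r2θ : 𝓤 → 𝓩 → EuclideanSpace ℝ (Fin d2)) (u : 𝓤) (z : 𝓩) :
    EuclideanSpace ℝ (Fin (d1 + d2)) :=
  (EuclideanSpace.equiv (Fin (d1 + d2)) ℝ).symm
    (Fin.append (EuclideanSpace.equiv (Fin d1) ℝ (r1θ z))
      (EuclideanSpace.equiv (Fin d2) ℝ (r2θ u z)))

/-- The partial support function `γ₂(λ,z;θ) = sup {λᵀ r₂(u,z;θ) : u ∈ Γ(z;θ)}`. -/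
def suppFun2 {d2 : ℕ} (Γθ : Set (𝓤 × 𝓩)) (r2θ : 𝓤 → 𝓩 → EuclideanSpace ℝ (Fin d2))
    (l : EuclideanSpace ℝ (Fin d2)) (z : 𝓩) : EReal :=
  sSup ((fun u => ((⟪l, r2θ u z⟫ : ℝ) : EReal)) '' sectionSet Γθ z)

/-- Convexity of a family of (probability) measures. -/
def ConvexFamily (𝓕 : Set (Measure 𝓩)) : Prop :=
  ∀ F₁ ∈ 𝓕, ∀ F₂ ∈ 𝓕, ∀ δ : ℝ, 0 ≤ δ → δ ≤ 1 →
    (ENNReal.ofReal δ • F₁ + ENNReal.ofReal (1 - δ) • F₂) ∈ 𝓕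

/-- Finite-sample indistinguishability of the hypotheses `θ ∈ Θ_I(F)` and `θ ∈ Θ̄_I(F)`:
for every sample size `n` and every (measurable, `[0,1]`-valued) test `φ`, the supremum of the
rejection probability over `𝓕_θ` equals the supremum over `𝓕̄_θ`. -/
def Indistinguishable {d : ℕ} (𝓕 : Set (Measure 𝓩)) (Γθ : Set (𝓤 × 𝓩))
    (rθ : 𝓤 → 𝓩 → EuclideanSpace ℝ (Fin d)) : Prop :=
  ∀ (n : ℕ) (φ : (Fin n → 𝓩) → ℝ), Measurable φ → (∀ x, φ x ∈ Set.Icc (0 : ℝ) 1) →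
    sSup ((fun F : Measure 𝓩 => ∫ x, φ x ∂(Measure.pi fun _ : Fin n => F)) ''
        {F ∈ 𝓕 | MemIdentified Γθ rθ F}) =
      sSup ((fun F : Measure 𝓩 => ∫ x, φ x ∂(Measure.pi fun _ : Fin n => F)) ''
        {F ∈ 𝓕 | MemMomentClosure Γθ rθ F})

theorem isCompact_setOf_forall_le_nat (b : ℕ → ℕ) : IsCompact {x : ℕ → ℕ | ∀ i, x i ≤ b i} := by
  have : {x : ℕ → ℕ | ∀ i, x i ≤ b i} = Set.Icc ⊥ b := by
    ext x; simp [Pi.le_def]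
  rw [this]
  exact isCompact_Icc

/-- The image under a continuous map of the sequences `x` with `x i ≤ b i` can be approximated in
measure from within an open superset by images of the sequences bounded on an initial segment. -/
theorem exists_image_prefix_bounded_subset {Z : Type*} [TopologicalSpace Z] {f : (ℕ → ℕ) → Z}
    (hf : Continuous f) (b : ℕ → ℕ) {U : Set Z} (hU : IsOpen U)
    (hbU : f '' {x | ∀ i, x i ≤ b i} ⊆ U) : ∃ k, f '' {x | ∀ i < k, x i ≤ b i} ⊆ U := by
  let := PiNat.metricSpaceNatNat
  obtain ⟨δ, hδ, hsub⟩ := (isCompact_setOf_forall_le_nat b).exists_thickening_subset_open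
    (hU.preimage hf) (image_subset_iff.1 hbU)
  obtain ⟨k, hk⟩ := exists_pow_lt_of_lt_one hδ (by norm_num : (1 / 2 : ℝ) < 1)
  refine ⟨k, image_subset_iff.2 fun x hx => hsub ?_⟩
  refine Metric.mem_thickening_iff.2 ⟨fun i => min (x i) (b i), fun i => min_le_right _ _, ?_⟩
  refine lt_of_le_of_lt (PiNat.mem_cylinder_iff_dist_le.1 ?_) hk
  exact PiNat.mem_cylinder_iff.2 fun i hi => (min_eq_left (hx i hi)).symm

theorem exists_isCompact_subset_range_le_measure {Z : Type*} [TopologicalSpace Z]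
    [MeasurableSpace Z] {μ : Measure Z} [μ.OuterRegular] {f : (ℕ → ℕ) → Z}
    (hf : Continuous f) {c : ℝ≥0∞} (hc : c < μ (range f)) :
    ∃ K ⊆ range f, IsCompact K ∧ c ≤ μ K := by
  have step : ∀ (S : Set (ℕ → ℕ)) (k : ℕ), c < μ (f '' S) →
      ∃ m, c < μ (f '' (S ∩ {x | x k ≤ m})) := by
    intro S k hS
    have hmono : Monotone fun m : ℕ => f '' (S ∩ {x | x k ≤ m}) := fun m n hmn =>
      image_mono (inter_subset_inter_right _ fun x hx => le_trans hx hmn)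
    have hun : ⋃ m : ℕ, f '' (S ∩ {x | x k ≤ m}) = f '' S := by
      rw [← image_iUnion, ← inter_iUnion, (_ : ⋃ m : ℕ, {x : ℕ → ℕ | x k ≤ m} = univ), inter_univ]
      exact eq_univ_of_forall fun x => mem_iUnion.2 ⟨x k, le_refl (x k)⟩
    rw [← hun, hmono.measure_iUnion] at hS
    exact lt_iSup_iff.1 hS
  choose! m hm using step
  let S : ℕ → Set (ℕ → ℕ) := fun k => Nat.rec univ (fun k T => T ∩ {x | x k ≤ m T k}) k
  have hS : ∀ k, c < μ (f '' S k) := by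
    intro k
    induction k with
    | zero => simpa [S] using hc
    | succ k ih => exact hm _ _ ih
  let b : ℕ → ℕ := fun k => m (S k) k
  have hSb : ∀ k, S k = {x | ∀ i < k, x i ≤ b i} := by
    intro k
    induction k with
    | zero => simp [S]
    | succ k ih =>
      have : S (k + 1) = S k ∩ {x | x k ≤ b k} := rfl
      rw [this, ih]
      ext x
      refine ⟨fun h i hi => ?_, fun h => ⟨fun i hi => h i (by lia), h k (by lia)⟩⟩
      rcases Nat.lt_succ_iff_lt_or_eq.1 hi with hi | rfl
      exacts [h.1 i hi, h.2]
  refine ⟨f '' {x | ∀ i, x i ≤ b i}, image_subset_range _ _,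
    (isCompact_setOf_forall_le_nat b).image hf, ?_⟩
  · by_contra! hlt
    obtain ⟨U, hsub, hU, hUc⟩ := Set.exists_isOpen_lt_of_lt _ _ hlt
    obtain ⟨k, hk⟩ := exists_image_prefix_bounded_subset hf b hU hsub
    have := hS k
    rw [hSb k] at this
    exact absurd (this.trans_le (measure_mono hk)) hUc.not_gt

/-- Analytic sets are universally measurable. -/
theorem MeasureTheory.AnalyticSet.nullMeasurableSet {Z : Type*} [TopologicalSpace Z] [T2Space Z]
    [MeasurableSpace Z] [OpensMeasurableSpace Z] {μ : Measure Z} [IsFiniteMeasure μ]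
    [μ.OuterRegular] {s : Set Z} (hs : AnalyticSet s) : NullMeasurableSet s μ := by
  rw [AnalyticSet] at hs
  rcases hs with rfl | ⟨f, hf, rfl⟩
  · exact nullMeasurableSet_empty
  rcases eq_or_ne (μ (range f)) 0 with h0 | h0
  · exact NullMeasurableSet.of_null h0
  obtain ⟨u, -, hu, hlim⟩ := exists_seq_strictMono_tendsto' (pos_iff_ne_zero.2 h0)
  choose K hKsub hK hKle using fun n => exists_isCompact_subset_range_le_measure hf (hu n).2
  have hT : MeasurableSet (⋃ n, K n) := MeasurableSet.iUnion fun n => (hK n).measurableSet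
  refine hT.nullMeasurableSet.congr ?_
  refine ae_eq_of_subset_of_measure_ge (iUnion_subset hKsub) ?_ hT.nullMeasurableSet
    (measure_ne_top _ _)
  exact le_of_tendsto' hlim fun n => (hKle n).trans (measure_mono (subset_iUnion K n))

theorem exists_measurable_rightInverse_ae {Z : Type*} [TopologicalSpace Z] [T2Space Z]
    [MeasurableSpace Z] [OpensMeasurableSpace Z] {μ : Measure Z} [IsFiniteMeasure μ]
    [μ.OuterRegular] {f : (ℕ → ℕ) → Z} (hf : Continuous f) (hμ : ∀ᵐ z ∂μ, z ∈ range f) :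
    ∃ s : Z → ℕ → ℕ, Measurable s ∧ ∀ᵐ z ∂μ, f (s z) = z := by
  classical
  let A : List ℕ → Set Z := fun l => f '' {x | PiNat.res x l.length = l}
  have hA : ∀ l, NullMeasurableSet (A l) μ := by
    intro l
    refine AnalyticSet.nullMeasurableSet ?_
    refine IsOpen.analyticSet_image ?_ hf
    have h2 : {x : ℕ → ℕ | PiNat.res x l.length = l} =
        ⋃ y ∈ {y : ℕ → ℕ | PiNat.res y l.length = l}, PiNat.cylinder y l.length := by
      ext x
      simp only [PiNat.cylinder_eq_res, mem_ofPred_eq, mem_iUnion, exists_prop]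
      exact ⟨fun h => ⟨x, h, rfl⟩, fun ⟨y, hy, h⟩ => h.trans hy⟩
    rw [h2]
    exact isOpen_biUnion fun y _ => PiNat.isOpen_cylinder _ y _
  choose B hB hBm hBA using fun l => (hA l).exists_measurable_superset_ae_eq
  let p : List ℕ → Z → ℕ → Prop := fun l z m => z ∈ B (m :: l) ∨ z ∉ ⋃ m, B (m :: l)
  have hp : ∀ l z, ∃ m, p l z m := by
    intro l z
    by_cases h : z ∈ ⋃ m, B (m :: l)
    · obtain ⟨m, hm⟩ := mem_iUnion.1 h
      exact ⟨m, Or.inl hm⟩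
    · exact ⟨0, Or.inr h⟩
  let : MeasurableSpace (List ℕ) := ⊤
  let next : Z × List ℕ → ℕ := fun q => Nat.find (hp q.2 q.1)
  have hnext : Measurable next := by
    refine measurable_from_prod_countable_left fun l => ?_
    refine measurable_find (hp l) fun m => ?_
    exact (hBm _).union (MeasurableSet.iUnion fun m => hBm _).compl
  let pre : Z → ℕ → List ℕ := fun z k => Nat.rec [] (fun _ l => next (z, l) :: l) k
  have hpre : ∀ k, Measurable fun z => pre z k := by
    intro k
    induction k with
    | zero => exact measurable_const
    | succ k ih =>
      have hcons : Measurable fun q : ℕ × List ℕ => q.1 :: q.2 := measurable_of_countable _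
      exact hcons.comp ((hnext.comp (measurable_id.prodMk ih)).prodMk ih)
  have hlen : ∀ z k, (pre z k).length = k := by
    intro z k
    induction k with
    | zero => rfl
    | succ k ih => exact congrArg Nat.succ ih
  refine ⟨fun z k => next (z, pre z k),
    measurable_pi_lambda _ fun k => hnext.comp (measurable_id.prodMk (hpre k)), ?_⟩
  have hres : ∀ z k, PiNat.res (fun k => next (z, pre z k)) k = pre z k := by
    intro z k
    induction k with
    | zero => rfl
    | succ k ih => rw [PiNat.res_succ, ih]
  have hae : ∀ᵐ z ∂μ, ∀ l, z ∈ B l ↔ z ∈ A l := by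
    rw [ae_all_iff]
    exact fun l => (hBA l).mem_iff
  filter_upwards [hμ, hae] with z hz hzBA
  have hmem : ∀ k, z ∈ A (pre z k) := by
    intro k
    induction k with
    | zero =>
      obtain ⟨x, rfl⟩ := hz
      exact ⟨x, rfl, rfl⟩
    | succ k ih =>
      obtain ⟨x, hx, hxz⟩ := ih
      have hun : z ∈ ⋃ m, B (m :: pre z k) := by
        refine mem_iUnion.2 ⟨x k, (hzBA _).2 ⟨x, ?_, hxz⟩⟩
        rw [mem_ofPred_eq, hlen] at hx
        simp [PiNat.res_succ, hlen, hx]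
      exact (hzBA _).1 ((Nat.find_spec (hp (pre z k) z)).resolve_right (not_not.2 hun))
  choose x hx hxz using hmem
  have hlim : Filter.Tendsto x Filter.atTop (nhds fun k => next (z, pre z k)) := by
    refine tendsto_pi_nhds.2 fun i => tendsto_const_nhds.congr' ?_
    filter_upwards [Filter.eventually_gt_atTop i] with k hk
    have h := hx k
    rw [mem_ofPred_eq, hlen, ← hres z k] at h
    exact (PiNat.res_eq_res.1 h hk).symm
  refine tendsto_nhds_unique ((hf.tendsto _).comp hlim) ?_
  exact tendsto_const_nhds.congr fun k => (hxz k).symm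

/-- Measurable selection almost everywhere from a Borel set of a product of Polish spaces. -/
theorem MeasurableSet.exists_measurable_selection_ae {U Z : Type*}
    [MeasurableSpace U] [TopologicalSpace U] [PolishSpace U] [BorelSpace U]
    [MeasurableSpace Z] [TopologicalSpace Z] [PolishSpace Z] [BorelSpace Z]
    {μ : Measure Z} [IsFiniteMeasure μ] [Nonempty U] {B : Set (U × Z)} (hB : MeasurableSet B)
    (hμ : ∀ᵐ z ∂μ, ∃ u, (u, z) ∈ B) :
    ∃ s : Z → U, Measurable s ∧ ∀ᵐ z ∂μ, (s z, z) ∈ B := by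
  have hBa := hB.analyticSet
  rw [AnalyticSet] at hBa
  rcases hBa with rfl | ⟨g, hg, rfl⟩
  · exact ⟨fun _ => Classical.arbitrary U, measurable_const, hμ.mono fun z ⟨u, hu⟩ => hu.elim⟩
  · obtain ⟨s, hs, hsz⟩ := exists_measurable_rightInverse_ae (μ := μ) (continuous_snd.comp hg)
      (hμ.mono fun z ⟨u, x, hx⟩ => ⟨x, by simp [hx]⟩)
    refine ⟨fun z => (g (s z)).1, measurable_fst.comp (hg.measurable.comp hs), ?_⟩
    exact hsz.mono fun z hz => ⟨s z, Prod.ext rfl hz⟩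

theorem aemeasurable_of_nullMeasurableSet_lt {Z : Type*} [MeasurableSpace Z] {μ : Measure Z}
    {f : Z → EReal} (hf : ∀ c : EReal, NullMeasurableSet {z | c < f z} μ) : AEMeasurable f μ := by
  classical
  choose B _ hBm hBf using
    fun q : ℚ => (hf ((q : ℝ) : EReal)).exists_measurable_superset_ae_eq
  refine ⟨fun z => ⨆ q : ℚ, (B q).piecewise (fun _ => ((q : ℝ) : EReal)) (fun _ => ⊥) z,
    Measurable.iSup fun q => measurable_const.piecewise (hBm q) measurable_const, ?_⟩
  filter_upwards [ae_all_iff.2 fun q => (hBf q).mem_iff] with z hz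
  refine le_antisymm (le_of_forall_lt fun c hc => ?_) (iSup_le fun q => ?_)
  · obtain ⟨q, hcq, hqf⟩ := EReal.lt_iff_exists_rat_btwn.1 hc
    refine hcq.trans_le (le_iSup_of_le q ?_)
    rw [piecewise_eq_of_mem _ _ _ ((hz q).2 hqf)]
  · by_cases h : z ∈ B q
    · rw [piecewise_eq_of_mem _ _ _ h]
      exact le_of_lt ((hz q).1 h)
    · rw [piecewise_eq_of_notMem _ _ _ h]
      exact bot_le

theorem zero_mem_of_forall_exists_inner_pos {E : Type*} [NormedAddCommGroup E]
    [InnerProductSpace ℝ E] [FiniteDimensional ℝ E] {M : Set E} (hM : Convex ℝ M)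
    (hne : M.Nonempty) (h : ∀ l : E, ‖l‖ = 1 → ∃ m ∈ M, 0 < ⟪l, m⟫) : (0 : E) ∈ M := by
  obtain ⟨m₀, hm₀⟩ := hne
  choose! m hmM hm using h
  obtain ⟨t, ht, hcov⟩ := (isCompact_sphere (0 : E) 1).elim_nhds_subcover
    (fun l => {k | 0 < ⟪k, m l⟫}) fun l hl =>
      (isOpen_lt continuous_const (by fun_prop)).mem_nhds (hm l (by simpa using hl))
  let T : Set E := insert m₀ (m '' t)
  have hTfin : T.Finite := (t.finite_toSet.image m).insert m₀
  have hTM : T ⊆ M := insert_subset hm₀ (image_subset_iff.2 fun l hl =>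
    hmM l (by simpa using ht l hl))
  refine convexHull_min hTM hM ?_
  by_contra h0
  obtain ⟨f, u, hfu, hf⟩ := geometric_hahn_banach_point_closed (convex_convexHull ℝ T)
    (hTfin.isCompact_convexHull ℝ).isClosed h0
  rw [map_zero] at hfu
  have hpos : ∀ x ∈ T, 0 < f x := fun x hx => hfu.trans (hf x (subset_convexHull ℝ T hx))
  obtain ⟨v, rfl⟩ := (InnerProductSpace.toDual ℝ E).surjective f
  simp only [InnerProductSpace.toDual_apply_apply] at hpos
  have hv : v ≠ 0 := by
    rintro rfl
    simpa using hpos m₀ (mem_insert _ _)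
  have hl : -(‖v‖⁻¹ • v) ∈ Metric.sphere (0 : E) 1 := by
    rw [mem_sphere_zero_iff_norm, norm_neg, norm_smul, norm_inv, norm_norm,
      inv_mul_cancel₀ (norm_ne_zero_iff.2 hv)]
  obtain ⟨k, hkt, hk⟩ := mem_iUnion₂.1 (hcov hl)
  have h1 := hpos (m k) (mem_insert_of_mem _ (mem_image_of_mem _ hkt))
  rw [mem_ofPred_eq, inner_neg_left, real_inner_smul_left] at hk
  have : 0 < ‖v‖⁻¹ * ⟪v, m k⟫ := by positivity
  linarith

theorem EReal.measurable_posPart : Measurable EReal.posPart :=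
  Measurable.ite (measurableSet_singleton _) measurable_const measurable_ereal_toReal.ennreal_ofReal

theorem EReal.posPart_coe (x : ℝ) : (x : EReal).posPart = ENNReal.ofReal x := by
  simp [EReal.posPart]

theorem EReal.posPart_mono : Monotone EReal.posPart := by
  intro x y hxy
  induction x <;> induction y <;> simp_all [EReal.posPart]
  exact ENNReal.ofReal_le_ofReal hxy

theorem exists_integrable_lt_of_integralEReal_pos {Z : Type*} [MeasurableSpace Z] {μ : Measure Z}
    [IsProbabilityMeasure μ] {f : Z → EReal} (hf : AEMeasurable f μ) (hbot : ∀ z, f z ≠ ⊥)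
    (hpos : 0 < integralEReal μ f) :
    ∃ φ : Z → ℝ, Integrable φ μ ∧ (∀ z, (φ z : EReal) < f z) ∧ 0 < ∫ z, φ z ∂μ := by
  have hP : AEMeasurable (fun z => (f z).posPart) μ :=
    EReal.measurable_posPart.comp_aemeasurable hf
  have hN : AEMeasurable (fun z => (-f z).posPart) μ :=
    EReal.measurable_posPart.comp_aemeasurable hf.neg
  rw [integralEReal, EReal.sub_pos, EReal.coe_ennreal_lt_coe_ennreal_iff] at hpos
  have hsup : ∫⁻ z, (f z).posPart ∂μ = ⨆ n : ℕ, ∫⁻ z, min (f z).posPart n ∂μ := by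
    rw [← lintegral_iSup' (fun n => hP.min aemeasurable_const)]
    · refine lintegral_congr fun z => ?_
      rw [← inf_iSup_eq, ENNReal.iSup_natCast, inf_top_eq]
    · exact Filter.Eventually.of_forall fun z m n hmn =>
        min_le_min_left _ (Nat.cast_le.2 hmn)
  rw [hsup] at hpos
  obtain ⟨n, hn⟩ := lt_iSup_iff.1 hpos
  have hPn : ∫⁻ z, min (f z).posPart n ∂μ ≠ ⊤ := by
    refine ne_top_of_le_ne_top (b := ∫⁻ _, (n : ℝ≥0∞) ∂μ) (by simp) ?_
    exact lintegral_mono fun z => min_le_right _ _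
  have hNt : ∫⁻ z, (-f z).posPart ∂μ ≠ ⊤ := hn.ne_top
  have hPi := integrable_toReal_of_lintegral_ne_top (hP.min aemeasurable_const) hPn
  have hNi := integrable_toReal_of_lintegral_ne_top hN hNt
  have hfin : ∀ z, min (f z).posPart n ≠ ⊤ := fun z =>
    ne_top_of_le_ne_top (ENNReal.natCast_ne_top n) (min_le_right _ _)
  have hneg : ∀ z, (-f z).posPart ≠ ⊤ := by
    intro z
    have := hbot z
    induction hz : f z with
    | bot => exact absurd hz this
    | top => simp [EReal.posPart]
    | coe x => rw [← EReal.coe_neg, EReal.posPart_coe]; exact ENNReal.ofReal_ne_top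
  have hint : 0 < ∫ z, ((min (f z).posPart n).toReal - (-f z).posPart.toReal) ∂μ := by
    rw [integral_sub hPi hNi,
      integral_toReal (hP.min aemeasurable_const) (.of_forall fun z => (hfin z).lt_top),
      integral_toReal hN (.of_forall fun z => (hneg z).lt_top), sub_pos]
    exact (ENNReal.toReal_lt_toReal hNt hPn).2 hn
  set c := ∫ z, ((min (f z).posPart n).toReal - (-f z).posPart.toReal) ∂μ
  refine ⟨fun z => (min (f z).posPart n).toReal - (-f z).posPart.toReal - c / 2,
    hPi.sub hNi |>.sub (integrable_const _), fun z => ?_, ?_⟩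
  · beta_reduce
    have := hbot z
    induction hz : f z with
    | bot => exact absurd hz this
    | top => exact EReal.coe_lt_top _
    | coe x =>
      rw [← EReal.coe_neg, EReal.posPart_coe, EReal.posPart_coe, EReal.coe_lt_coe_iff]
      have h1 : (min (ENNReal.ofReal x) n).toReal ≤ max x 0 :=
        (ENNReal.toReal_mono ENNReal.ofReal_ne_top (min_le_left _ _)).trans_eq
          ENNReal.toReal_ofReal'
      rw [ENNReal.toReal_ofReal']
      have h2 : max x 0 - max (-x) 0 = x := by
        rcases le_total x 0 with h | h <;> simp [h]
      linarith
  · have hsub : ∫ z, ((min (f z).posPart n).toReal - (-f z).posPart.toReal - c / 2) ∂μ =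
        c - ∫ _, c / 2 ∂μ := integral_sub (hPi.sub hNi) (integrable_const _)
    simp only [hsub, integral_const, probReal_univ, one_smul]
    linarith

/-- The moments `∫ r dH` over the admissible measures `H` under which `r` is integrable. -/
def attainableMoments {d : ℕ} (Γθ : Set (𝓤 × 𝓩)) (rθ : 𝓤 → 𝓩 → EuclideanSpace ℝ (Fin d))
    (F : Measure 𝓩) : Set (EuclideanSpace ℝ (Fin d)) :=
  {m | ∃ H : Measure (𝓤 × 𝓩), IsProbabilityMeasure H ∧ H Γθ = 1 ∧ H.map Prod.snd = F ∧
    Integrable (fun p : 𝓤 × 𝓩 => rθ p.1 p.2) H ∧ (∫ p : 𝓤 × 𝓩, rθ p.1 p.2 ∂H) = m}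

theorem convex_attainableMoments {U Z : Type*} [MeasurableSpace U] [MeasurableSpace Z] {d : ℕ}
    (Γθ : Set (U × Z)) (rθ : U → Z → EuclideanSpace ℝ (Fin d)) (F : Measure Z) :
    Convex ℝ (attainableMoments Γθ rθ F) := by
  rintro _ ⟨H, hH, hHΓ, hHF, hHi, rfl⟩ _ ⟨K, hK, hKΓ, hKF, hKi, rfl⟩ a b ha hb hab
  have hab' : ENNReal.ofReal a + ENNReal.ofReal b = 1 := by
    rw [← ENNReal.ofReal_add ha hb, hab, ENNReal.ofReal_one]
  refine ⟨ENNReal.ofReal a • H + ENNReal.ofReal b • K, ⟨?_⟩, ?_, ?_, ?_, ?_⟩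
  · simpa using hab'
  · simpa [hHΓ, hKΓ] using hab'
  · rw [Measure.map_add _ _ measurable_snd, Measure.map_smul, Measure.map_smul, hHF, hKF,
      ← add_smul, hab', one_smul]
  · exact (hHi.smul_measure ENNReal.ofReal_ne_top).add_measure
      (hKi.smul_measure ENNReal.ofReal_ne_top)
  · rw [integral_add_measure (hHi.smul_measure ENNReal.ofReal_ne_top)
      (hKi.smul_measure ENNReal.ofReal_ne_top), integral_smul_measure, integral_smul_measure,
      ENNReal.toReal_ofReal ha, ENNReal.toReal_ofReal hb]

/-- Replacing an admissible measure on the fibres over a measurable set `A` by a measurable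
selection `s` of `Γ(·;θ)` along which `r` is bounded gives another attainable moment. -/
theorem setIntegral_add_setIntegral_mem_attainableMoments {U Z : Type*}
    [MeasurableSpace U] [MeasurableSpace Z] {d : ℕ} {Γθ : Set (U × Z)}
    {rθ : U → Z → EuclideanSpace ℝ (Fin d)} {F : Measure Z} [IsProbabilityMeasure F]
    (hΓ : MeasurableSet Γθ) (hr : Measurable fun p : U × Z => rθ p.1 p.2)
    {H : Measure (U × Z)} [IsProbabilityMeasure H] (hHΓ : H Γθ = 1) (hHF : H.map Prod.snd = F)
    (hHi : Integrable (fun p : U × Z => rθ p.1 p.2) H) {s : Z → U} (hs : Measurable s)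
    (hsΓ : ∀ᵐ z ∂F, (s z, z) ∈ Γθ) {A : Set Z} (hA : MeasurableSet A) {C : ℝ}
    (hC : ∀ z ∈ A, ‖rθ (s z) z‖ ≤ C) :
    ∫ p in Prod.snd ⁻¹' Aᶜ, rθ p.1 p.2 ∂H + ∫ z in A, rθ (s z) z ∂F ∈
      attainableMoments Γθ rθ F := by
  have hsm : Measurable fun z => (s z, z) := hs.prodMk measurable_id
  set K := H.restrict (Prod.snd ⁻¹' Aᶜ) + (F.restrict A).map fun z => (s z, z) with hKdef
  have hKF : K.map Prod.snd = F := by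
    rw [hKdef, Measure.map_add _ _ measurable_snd, ← Measure.restrict_map measurable_snd hA.compl,
      hHF, Measure.map_map measurable_snd hsm]
    have : Prod.snd ∘ (fun z => (s z, z)) = id := rfl
    rw [this, Measure.map_id, Measure.restrict_compl_add_restrict hA]
  have hKprob : IsProbabilityMeasure K := by
    constructor
    rw [← preimage_univ (f := Prod.snd), ← Measure.map_apply measurable_snd MeasurableSet.univ,
      hKF, measure_univ]
  have hsint : IntegrableOn (fun z => rθ (s z) z) A F :=
    Measure.integrableOn_of_bounded (measure_ne_top _ _)
      (hr.comp hsm).aestronglyMeasurable ((ae_restrict_iff' hA).2 (.of_forall hC))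
  have hmapint : Integrable (fun p : U × Z => rθ p.1 p.2)
      ((F.restrict A).map fun z => (s z, z)) :=
    (integrable_map_measure hr.aestronglyMeasurable hsm.aemeasurable).2 hsint
  refine ⟨K, hKprob, ?_, hKF, hHi.restrict.add_measure hmapint, ?_⟩
  · rw [← mem_ae_iff_prob_eq_one hΓ]
    change ∀ᵐ p ∂K, p ∈ Γθ
    rw [hKdef, ae_add_measure_iff]
    refine ⟨ae_restrict_of_ae ((mem_ae_iff_prob_eq_one hΓ).2 hHΓ), ?_⟩
    exact (ae_map_iff (p := fun p => p ∈ Γθ) hsm.aemeasurable hΓ).2 (ae_restrict_of_ae hsΓ)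
  · rw [integral_add_measure hHi.restrict hmapint,
      integral_map hsm.aemeasurable hr.aestronglyMeasurable]

theorem exists_attainableMoments_inner_pos {d : ℕ} {Γθ : Set (𝓤 × 𝓩)}
    {rθ : 𝓤 → 𝓩 → EuclideanSpace ℝ (Fin d)} {F : Measure 𝓩} [IsProbabilityMeasure F]
    (hΓ : MeasurableSet Γθ) (hr : Measurable fun p : 𝓤 × 𝓩 => rθ p.1 p.2)
    (hne : (attainableMoments Γθ rθ F).Nonempty) {l : EuclideanSpace ℝ (Fin d)} {φ : 𝓩 → ℝ}
    (hφ : Integrable φ F) (hlt : ∀ z, ∃ u, (u, z) ∈ Γθ ∧ φ z < ⟪l, rθ u z⟫)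
    (hpos : 0 < ∫ z, φ z ∂F) : ∃ m ∈ attainableMoments Γθ rθ F, 0 < ⟪l, m⟫ := by
  obtain ⟨_, H, hH, hHΓ, hHF, hHi, -⟩ := hne
  have : Nonempty 𝓤 := H.nonempty_of_neZero.map Prod.fst
  set ψ := hφ.aemeasurable.mk φ with hψdef
  have hψm : Measurable ψ := hφ.aemeasurable.measurable_mk
  have hψφ : φ =ᵐ[F] ψ := hφ.aemeasurable.ae_eq_mk
  have hψ : Integrable ψ F := hφ.congr hψφ
  rw [integral_congr_ae hψφ] at hpos
  have hinner : Measurable fun p : 𝓤 × 𝓩 => ⟪l, rθ p.1 p.2⟫ := hr.const_inner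
  obtain ⟨s, hs, hsB⟩ := MeasurableSet.exists_measurable_selection_ae (μ := F)
    (hΓ.inter (measurableSet_lt (hψm.comp measurable_snd) hinner)) (by
      filter_upwards [hψφ] with z hz
      obtain ⟨u, hu, hlt⟩ := hlt z
      exact ⟨u, hu, by simpa [hz] using hlt⟩)
  have hnorm : Measurable fun z => ‖rθ (s z) z‖ := (hr.comp (hs.prodMk measurable_id)).norm
  let A : ℕ → Set 𝓩 := fun n => {z | ‖rθ (s z) z‖ ≤ n}
  have hA : ∀ n, MeasurableSet (A n) := fun n => measurableSet_le hnorm measurable_const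
  have hAmono : Monotone A := fun m n hmn z (hz : ‖rθ (s z) z‖ ≤ m) => hz.trans (Nat.cast_le.2 hmn)
  have hAun : ⋃ n, A n = univ :=
    eq_univ_of_forall fun z => mem_iUnion.2 (exists_nat_ge ‖rθ (s z) z‖)
  have hmem := fun n => setIntegral_add_setIntegral_mem_attainableMoments hΓ hr hHΓ hHF hHi hs
    (hsB.mono fun z hz => hz.1) (hA n) fun z hz => hz
  have hHi' : Integrable (fun p : 𝓤 × 𝓩 => ⟪l, rθ p.1 p.2⟫) H := hHi.const_inner l
  have hlim : Filter.Tendsto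
      (fun n => ∫ p in Prod.snd ⁻¹' (A n)ᶜ, ⟪l, rθ p.1 p.2⟫ ∂H + ∫ z in A n, ψ z ∂F)
      Filter.atTop (nhds (0 + ∫ z, ψ z ∂F)) := by
    refine Filter.Tendsto.add ?_ ?_
    · have h := tendsto_setIntegral_of_antitone (μ := H)
        (f := fun p : 𝓤 × 𝓩 => ⟪l, rθ p.1 p.2⟫) (s := fun n => Prod.snd ⁻¹' (A n)ᶜ)
        (fun n => measurable_snd (hA n).compl)
        (fun m n hmn => preimage_mono (compl_subset_compl.2 (hAmono hmn))) ⟨0, hHi'.integrableOn⟩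
      rwa [← preimage_iInter, ← compl_iUnion, hAun, compl_univ, preimage_empty,
        setIntegral_empty] at h
    · have h := tendsto_setIntegral_of_monotone hA hAmono (f := ψ) (μ := F) hψ.integrableOn
      rwa [hAun, setIntegral_univ] at h
  rw [zero_add] at hlim
  obtain ⟨n, hn⟩ := (hlim.eventually_const_lt hpos).exists
  refine ⟨_, hmem n, hn.trans_le ?_⟩
  have hsint : IntegrableOn (fun z => rθ (s z) z) (A n) F :=
    Measure.integrableOn_of_bounded (M := n) (measure_ne_top _ _)
      (hr.comp (hs.prodMk measurable_id)).aestronglyMeasurable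
      ((ae_restrict_iff' (hA n)).2 (.of_forall fun z hz => hz))
  rw [inner_add_right, ← integral_inner hHi.restrict, ← integral_inner hsint]
  exact add_le_add le_rfl (integral_mono_ae hψ.integrableOn (hsint.const_inner l)
    (ae_restrict_of_ae (hsB.mono fun z hz => le_of_lt hz.2)))

theorem suppFun_eq_suppFun2 {U Z : Type*} {d : ℕ} (Γθ : Set (U × Z))
    (rθ : U → Z → EuclideanSpace ℝ (Fin d)) : suppFun Γθ rθ = suppFun2 Γθ rθ := by
  ext l z
  rw [suppFun, suppFun2, momentSet, image_image]

theorem lt_suppFun2_iff {U Z : Type*} {d : ℕ} {Γθ : Set (U × Z)}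
    {rθ : U → Z → EuclideanSpace ℝ (Fin d)} {l : EuclideanSpace ℝ (Fin d)} {z : Z} {c : EReal} :
    c < suppFun2 Γθ rθ l z ↔ ∃ u, (u, z) ∈ Γθ ∧ c < ((⟪l, rθ u z⟫ : ℝ) : EReal) := by
  simp [suppFun2, lt_sSup_iff, sectionSet]

theorem aemeasurable_suppFun2 {d : ℕ} {Γθ : Set (𝓤 × 𝓩)}
    {rθ : 𝓤 → 𝓩 → EuclideanSpace ℝ (Fin d)} {F : Measure 𝓩} [IsFiniteMeasure F]
    (hΓ : MeasurableSet Γθ) (hr : Measurable fun p : 𝓤 × 𝓩 => rθ p.1 p.2)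
    (l : EuclideanSpace ℝ (Fin d)) : AEMeasurable (suppFun2 Γθ rθ l) F := by
  refine aemeasurable_of_nullMeasurableSet_lt fun c => ?_
  have hB : MeasurableSet (Γθ ∩ {p | c < ((⟪l, rθ p.1 p.2⟫ : ℝ) : EReal)}) :=
    hΓ.inter (measurableSet_lt measurable_const hr.const_inner.coe_real_ereal)
  convert (hB.analyticSet.image_of_continuous continuous_snd).nullMeasurableSet (μ := F) using 1
  ext z
  simp [lt_suppFun2_iff]

theorem integralEReal_suppFun2_nonneg {d : ℕ} {Γθ : Set (𝓤 × 𝓩)}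
    {rθ : 𝓤 → 𝓩 → EuclideanSpace ℝ (Fin d)} {F : Measure 𝓩} [IsProbabilityMeasure F]
    (hΓ : MeasurableSet Γθ) (hr : Measurable fun p : 𝓤 × 𝓩 => rθ p.1 p.2)
    (hmem : MemMomentClosure Γθ rθ F) {l : EuclideanSpace ℝ (Fin d)} (hl : ‖l‖ = 1) :
    0 ≤ integralEReal F (suppFun2 Γθ rθ l) := by
  have hγ := aemeasurable_suppFun2 (F := F) hΓ hr l
  have key : ∀ ε : ℝ, 0 < ε → ∫⁻ z, (-suppFun2 Γθ rθ l z).posPart ∂F ≠ ⊤ ∧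
      ∫⁻ z, (-suppFun2 Γθ rθ l z).posPart ∂F ≤
        ∫⁻ z, (suppFun2 Γθ rθ l z).posPart ∂F + ENNReal.ofReal ε := by
    intro ε hε
    obtain ⟨H, hH, hHΓ, hHF, hHi, hle⟩ := hmem ε hε
    have hHi' : Integrable (fun p : 𝓤 × 𝓩 => ⟪l, rθ p.1 p.2⟫) H := hHi.const_inner l
    have hae : ∀ᵐ p ∂H, ((⟪l, rθ p.1 p.2⟫ : ℝ) : EReal) ≤ suppFun2 Γθ rθ l p.2 := by
      filter_upwards [(mem_ae_iff_prob_eq_one hΓ).2 hHΓ] with p hp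
      exact le_sSup (mem_image_of_mem _ hp)
    have hpos : ∫⁻ p, ENNReal.ofReal ⟪l, rθ p.1 p.2⟫ ∂H ≤
        ∫⁻ z, (suppFun2 Γθ rθ l z).posPart ∂F := by
      rw [← hHF] at hγ ⊢
      rw [lintegral_map' (EReal.measurable_posPart.comp_aemeasurable' hγ)
        measurable_snd.aemeasurable]
      refine lintegral_mono_ae (hae.mono fun p hp => ?_)
      rw [← EReal.posPart_coe]
      exact EReal.posPart_mono hp
    have hneg : ∫⁻ z, (-suppFun2 Γθ rθ l z).posPart ∂F ≤
        ∫⁻ p, ENNReal.ofReal (-⟪l, rθ p.1 p.2⟫) ∂H := by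
      rw [← hHF] at hγ ⊢
      rw [lintegral_map' (EReal.measurable_posPart.comp_aemeasurable' hγ.fun_neg)
        measurable_snd.aemeasurable]
      refine lintegral_mono_ae (hae.mono fun p hp => ?_)
      rw [← EReal.posPart_coe, EReal.coe_neg]
      exact EReal.posPart_mono (EReal.neg_le_neg_iff.2 hp)
    have hnegt : ∫⁻ p, ENNReal.ofReal (-⟪l, rθ p.1 p.2⟫) ∂H ≠ ⊤ :=
      hHi'.neg.lintegral_lt_top.ne
    have hpost : ∫⁻ p, ENNReal.ofReal ⟪l, rθ p.1 p.2⟫ ∂H ≠ ⊤ := hHi'.lintegral_lt_top.ne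
    refine ⟨ne_top_of_le_ne_top hnegt hneg, hneg.trans (le_trans ?_ (add_le_add_left hpos _))⟩
    have hint := integral_eq_lintegral_pos_part_sub_lintegral_neg_part hHi'
    have hlower : -ε ≤ ∫ p, ⟪l, rθ p.1 p.2⟫ ∂H := by
      rw [integral_inner hHi]
      have := abs_real_inner_le_norm l (∫ p : 𝓤 × 𝓩, rθ p.1 p.2 ∂H)
      rw [hl, one_mul] at this
      linarith [neg_abs_le ⟪l, ∫ p : 𝓤 × 𝓩, rθ p.1 p.2 ∂H⟫]
    rw [← ENNReal.toReal_le_toReal hnegt (ENNReal.add_ne_top.2 ⟨hpost, ENNReal.ofReal_ne_top⟩),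
      ENNReal.toReal_add hpost ENNReal.ofReal_ne_top, ENNReal.toReal_ofReal hε.le]
    linarith
  have hle : ∫⁻ z, (-suppFun2 Γθ rθ l z).posPart ∂F ≤ ∫⁻ z, (suppFun2 Γθ rθ l z).posPart ∂F := by
    refine ENNReal.le_of_forall_pos_le_add fun ε hε _ => ?_
    simpa using (key ε hε).2
  rw [integralEReal, EReal.sub_nonneg]
  · exact EReal.coe_ennreal_le_coe_ennreal_iff.2 hle
  · exact Or.inr (EReal.coe_ennreal_ne_coe_ennreal_iff.2 (key 1 one_pos).1)
  · exact Or.inr (EReal.coe_ennreal_ne_bot _)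

theorem exists_attainableMoments_inner_pos_of_integralEReal_pos {d : ℕ} {Γθ : Set (𝓤 × 𝓩)}
    {rθ : 𝓤 → 𝓩 → EuclideanSpace ℝ (Fin d)} {F : Measure 𝓩} [IsProbabilityMeasure F]
    (hΓ : MeasurableSet Γθ) (hne : ∀ z, (sectionSet Γθ z).Nonempty)
    (hr : Measurable fun p : 𝓤 × 𝓩 => rθ p.1 p.2) (hM : (attainableMoments Γθ rθ F).Nonempty)
    {l : EuclideanSpace ℝ (Fin d)} (hpos : 0 < integralEReal F (suppFun2 Γθ rθ l)) :
    ∃ m ∈ attainableMoments Γθ rθ F, 0 < ⟪l, m⟫ := by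
  have hbot : ∀ z, suppFun2 Γθ rθ l z ≠ ⊥ := fun z => by
    obtain ⟨u, hu⟩ := hne z
    exact (lt_suppFun2_iff.2 ⟨u, hu, EReal.bot_lt_coe _⟩).ne'
  obtain ⟨φ, hφ, hlt, hφpos⟩ :=
    exists_integrable_lt_of_integralEReal_pos (aemeasurable_suppFun2 hΓ hr l) hbot hpos
  refine exists_attainableMoments_inner_pos hΓ hr hM hφ (fun z => ?_) hφpos
  simpa using lt_suppFun2_iff.1 (hlt z)

theorem iInf_integralEReal_suppFun2_eq_zero {d : ℕ} {Γθ : Set (𝓤 × 𝓩)}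
    {rθ : 𝓤 → 𝓩 → EuclideanSpace ℝ (Fin d)} {F : Measure 𝓩} [IsProbabilityMeasure F]
    (hΓ : MeasurableSet Γθ) (hne : ∀ z, (sectionSet Γθ z).Nonempty)
    (hr : Measurable fun p : 𝓤 × 𝓩 => rθ p.1 p.2)
    (hmem : MemMomentClosure Γθ rθ F) (hnot : ¬ MemIdentified Γθ rθ F) :
    (⨅ l : {l : EuclideanSpace ℝ (Fin d) // ‖l‖ = 1},
      integralEReal F (suppFun2 Γθ rθ l.1)) = 0 := by
  refine le_antisymm ?_ (le_iInf fun l => integralEReal_suppFun2_nonneg hΓ hr hmem l.2)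
  by_contra! hpos
  obtain ⟨H, hH, hHΓ, hHF, hHi, -⟩ := hmem 1 one_pos
  have hM : (attainableMoments Γθ rθ F).Nonempty := ⟨_, H, hH, hHΓ, hHF, hHi, rfl⟩
  have hsep : ∀ l : EuclideanSpace ℝ (Fin d), ‖l‖ = 1 →
      ∃ m ∈ attainableMoments Γθ rθ F, 0 < ⟪l, m⟫ := fun l hl =>
    have ⟨_, hc, hle⟩ := lt_iInf_iff.1 hpos
    exists_attainableMoments_inner_pos_of_integralEReal_pos hΓ hne hr hM (hc.trans_le (hle ⟨l, hl⟩))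
  exact hnot (zero_mem_of_forall_exists_inner_pos (convex_attainableMoments Γθ rθ F) hM hsep)

theorem finAddEquivProd_rComb {U Z : Type*} {d1 d2 : ℕ} (r1θ : Z → EuclideanSpace ℝ (Fin d1))
    (r2θ : U → Z → EuclideanSpace ℝ (Fin d2)) (u : U) (z : Z) :
    EuclideanSpace.finAddEquivProd (rComb r1θ r2θ u z) = (r1θ z, r2θ u z) := by
  ext i <;> simp [rComb, EuclideanSpace.finAddEquivProd, EuclideanSpace.sumEquivProd,
    PiLp.sumPiLpEquivProdLpPiLp]

theorem measurable_of_measurable_rComb {U Z : Type*} [MeasurableSpace U] [MeasurableSpace Z]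
    {d1 d2 : ℕ} {r1θ : Z → EuclideanSpace ℝ (Fin d1)} {r2θ : U → Z → EuclideanSpace ℝ (Fin d2)}
    (h : Measurable fun p : U × Z => rComb r1θ r2θ p.1 p.2) :
    Measurable fun p : U × Z => r2θ p.1 p.2 := by
  have h' := (EuclideanSpace.finAddEquivProd.continuous.measurable.comp h).snd
  simpa only [Function.comp_def, finAddEquivProd_rComb] using h'

theorem integrable_rComb_iff {U Z : Type*} [MeasurableSpace U] [MeasurableSpace Z] {d1 d2 : ℕ}
    {r1θ : Z → EuclideanSpace ℝ (Fin d1)} {r2θ : U → Z → EuclideanSpace ℝ (Fin d2)}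
    {H : Measure (U × Z)} :
    Integrable (fun p : U × Z => rComb r1θ r2θ p.1 p.2) H ↔
      Integrable (fun p : U × Z => r1θ p.2) H ∧ Integrable (fun p : U × Z => r2θ p.1 p.2) H := by
  rw [← (EuclideanSpace.finAddEquivProd (𝕜 := ℝ) (n := d1) (m := d2)).integrable_comp_iff]
  simp only [finAddEquivProd_rComb]
  exact ⟨fun h => ⟨h.fst, h.snd⟩, fun h => h.1.prodMk h.2⟩

theorem finAddEquivProd_integral_rComb {U Z : Type*} [MeasurableSpace U] [MeasurableSpace Z]
    {d1 d2 : ℕ} {r1θ : Z → EuclideanSpace ℝ (Fin d1)} {r2θ : U → Z → EuclideanSpace ℝ (Fin d2)}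
    {H : Measure (U × Z)} (h1 : Integrable (fun p : U × Z => r1θ p.2) H)
    (h2 : Integrable (fun p : U × Z => r2θ p.1 p.2) H) :
    EuclideanSpace.finAddEquivProd (∫ p : U × Z, rComb r1θ r2θ p.1 p.2 ∂H) =
      (∫ p : U × Z, r1θ p.2 ∂H, ∫ p : U × Z, r2θ p.1 p.2 ∂H) := by
  rw [← integral_pair h1 h2, ← ContinuousLinearEquiv.integral_comp_comm]
  simp only [finAddEquivProd_rComb]

theorem integrable_comp_snd_of_map_eq {U Z : Type*} [MeasurableSpace U] [MeasurableSpace Z]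
    {E : Type*} [NormedAddCommGroup E] {f : Z → E} {F : Measure Z} {H : Measure (U × Z)}
    (hH : H.map Prod.snd = F) (hf : Integrable f F) : Integrable (fun p : U × Z => f p.2) H := by
  subst hH
  exact hf.comp_measurable measurable_snd

theorem integral_comp_snd_of_map_eq {U Z : Type*} [MeasurableSpace U] [MeasurableSpace Z]
    {E : Type*} [NormedAddCommGroup E] [NormedSpace ℝ E] {f : Z → E} {F : Measure Z}
    {H : Measure (U × Z)} (hH : H.map Prod.snd = F) (hf : Integrable f F) :
    ∫ p, f p.2 ∂H = ∫ z, f z ∂F := by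
  subst hH
  exact (integral_map measurable_snd.aemeasurable hf.aestronglyMeasurable).symm

theorem MemMomentClosure.of_rComb {U Z : Type*} [MeasurableSpace U] [MeasurableSpace Z]
    {d1 d2 : ℕ} {Γθ : Set (U × Z)} {r1θ : Z → EuclideanSpace ℝ (Fin d1)}
    {r2θ : U → Z → EuclideanSpace ℝ (Fin d2)} {F : Measure Z} (hr1 : Integrable r1θ F)
    (hmem : MemMomentClosure Γθ (rComb r1θ r2θ) F) :
    ∫ z, r1θ z ∂F = 0 ∧ MemMomentClosure Γθ r2θ F := by
  let L : EuclideanSpace ℝ (Fin (d1 + d2)) →L[ℝ]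
      EuclideanSpace ℝ (Fin d1) × EuclideanSpace ℝ (Fin d2) :=
    EuclideanSpace.finAddEquivProd.toContinuousLinearMap
  have key : ∀ ε : ℝ, 0 < ε → ∃ H : Measure (U × Z), IsProbabilityMeasure H ∧ H Γθ = 1 ∧
      H.map Prod.snd = F ∧ Integrable (fun p : U × Z => r2θ p.1 p.2) H ∧
      ‖(∫ z, r1θ z ∂F, ∫ p : U × Z, r2θ p.1 p.2 ∂H)‖ ≤ ε := by
    intro ε hε
    have hL : 0 < ‖L‖ + 1 := by positivity
    obtain ⟨H, hP, hΓ, hF, hint, hle⟩ := hmem (ε / (‖L‖ + 1)) (by positivity)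
    obtain ⟨hi1, hi2⟩ := integrable_rComb_iff.1 hint
    refine ⟨H, hP, hΓ, hF, hi2, ?_⟩
    rw [← integral_comp_snd_of_map_eq hF hr1, ← finAddEquivProd_integral_rComb hi1 hi2]
    calc ‖L (∫ p : U × Z, rComb r1θ r2θ p.1 p.2 ∂H)‖
        ≤ (‖L‖ + 1) * (ε / (‖L‖ + 1)) :=
          L.le_of_opNorm_le_of_le (by linarith) hle
      _ = ε := by field_simp
  constructor
  · refine norm_le_zero_iff.1 (le_of_forall_pos_le_add fun ε hε => ?_)
    obtain ⟨H, -, -, -, -, hle⟩ := key ε hε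
    rw [zero_add]
    exact (norm_fst_le (∫ z, r1θ z ∂F, ∫ p : U × Z, r2θ p.1 p.2 ∂H)).trans hle
  · intro ε hε
    obtain ⟨H, hP, hΓ, hF, hi2, hle⟩ := key ε hε
    exact ⟨H, hP, hΓ, hF, hi2,
      (norm_snd_le (∫ z, r1θ z ∂F, ∫ p : U × Z, r2θ p.1 p.2 ∂H)).trans hle⟩

theorem MemIdentified.rComb_of_integral_eq_zero {U Z : Type*} [MeasurableSpace U]
    [MeasurableSpace Z] {d1 d2 : ℕ} {Γθ : Set (U × Z)} {r1θ : Z → EuclideanSpace ℝ (Fin d1)}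
    {r2θ : U → Z → EuclideanSpace ℝ (Fin d2)} {F : Measure Z} (hr1 : Integrable r1θ F)
    (hzero : ∫ z, r1θ z ∂F = 0) (h : MemIdentified Γθ r2θ F) :
    MemIdentified Γθ (rComb r1θ r2θ) F := by
  obtain ⟨H, hP, hΓ, hF, hi2, h2⟩ := h
  have hi1 := integrable_comp_snd_of_map_eq hF hr1
  refine ⟨H, hP, hΓ, hF, integrable_rComb_iff.2 ⟨hi1, hi2⟩,
    EuclideanSpace.finAddEquivProd.map_eq_zero_iff.1 ?_⟩
  rw [finAddEquivProd_integral_rComb hi1 hi2, integral_comp_snd_of_map_eq hF hr1, hzero, h2]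
  rfl

/-- **Lemma C.1, part (ii) (boundary characterization of the gap between the identified set
and its moment closure).**  Suppose Assumption 1 holds, `F ∈ 𝓕`, `θ ∈ Θ`, and `r₁(·;θ)` is
`F`-integrable.  If `θ ∈ Θ̄_I(F)` but `θ ∉ Θ_I(F)`, then `∫ r₁(z;θ) dF = 0` and
`inf_{λ ∈ 𝒮₂} ∫ γ₂(λ,z;θ) dF = 0`; equivalently, `inf_{λ ∈ 𝒮} ∫ γ(λ,z;θ) dF = 0`. -/
theorem boundary_of_closure_gap {d1 d2 : ℕ}
    (𝓕 : Set (Measure 𝓩)) (hprob : ∀ F ∈ 𝓕, IsProbabilityMeasure F)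
    (Γ : Θ → Set (𝓤 × 𝓩)) (r1 : Θ → 𝓩 → EuclideanSpace ℝ (Fin d1))
    (r2 : Θ → 𝓤 → 𝓩 → EuclideanSpace ℝ (Fin d2))
    (h1 : Assumption1 𝓕 Γ (fun θ => rComb (r1 θ) (r2 θ)))
    (F : Measure 𝓩) (hF : F ∈ 𝓕) (θ : Θ)
    (hr1int : Integrable (r1 θ) F)
    (hmem : MemMomentClosure (Γ θ) (rComb (r1 θ) (r2 θ)) F)
    (hnot : ¬ MemIdentified (Γ θ) (rComb (r1 θ) (r2 θ)) F) :
    (∫ z, r1 θ z ∂F = 0) ∧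
      (⨅ l : {l : EuclideanSpace ℝ (Fin d2) // ‖l‖ = 1},
        integralEReal F (suppFun2 (Γ θ) (r2 θ) l.1)) = 0 ∧
      (⨅ l : {l : EuclideanSpace ℝ (Fin (d1 + d2)) // ‖l‖ = 1},
        integralEReal F (suppFun (Γ θ) (rComb (r1 θ) (r2 θ)) l.1)) = 0 := by
  have := hprob F hF
  have A := h1 θ F hF
  obtain ⟨hzero, hmem2⟩ := hmem.of_rComb hr1int
  refine ⟨hzero, iInf_integralEReal_suppFun2_eq_zero A.borel_Gamma A.nonempty_section
    (measurable_of_measurable_rComb A.measurable_r) hmem2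
    fun h => hnot (h.rComb_of_integral_eq_zero hr1int hzero), ?_⟩
  simp only [suppFun_eq_suppFun2]
  exact iInf_integralEReal_suppFun2_eq_zero A.borel_Gamma A.nonempty_section A.measurable_r
    hmem hnot

end
end

section
/- Sufficient condition for membership in the moment closure via the Aumann integral (Lemma B.4). Suppose Assumption 1 holds. For any F ∈ 𝓕 and θ ∈ Θ, if 0 belongs to the closure of the convex hull of the Aumann integral 𝔼_I(θ,F), then θ ∈ Θ̄_I(F). -/
open MeasureTheory Set
open scoped ENNReal RealInnerProductSpace

noncomputable section

variable {𝓤 𝓩 : Type*}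
  [MeasurableSpace 𝓤] [TopologicalSpace 𝓤] [PolishSpace 𝓤] [BorelSpace 𝓤]
  [MeasurableSpace 𝓩] [TopologicalSpace 𝓩] [PolishSpace 𝓩] [BorelSpace 𝓩]
  {Θ : Type*}

/-- The Aumann integral `𝔼_I(θ,F)`: the set of integrals `∫ f dF` over `F`-a.e.-measurable,
`F`-integrable selections `f` of the closure of the moment set `z ↦ cl 𝓡(z;θ)`. -/
def AumannIntegral {d : ℕ} (Γθ : Set (𝓤 × 𝓩)) (rθ : 𝓤 → 𝓩 → EuclideanSpace ℝ (Fin d))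
    (F : Measure 𝓩) : Set (EuclideanSpace ℝ (Fin d)) :=
  {v | ∃ f : 𝓩 → EuclideanSpace ℝ (Fin d), AEMeasurable f F ∧ Integrable f F ∧
    (∀ᵐ z ∂F, f z ∈ closure (momentSet Γθ rθ z)) ∧ (∫ z, f z ∂F) = v}

/-- A compact image has a Borel right inverse. -/
theorem IsCompact.exists_measurable_rightInverse {X Z : Type*} [TopologicalSpace X]
    [TopologicalSpace.MetrizableSpace X] [Nonempty X] [MeasurableSpace X] [BorelSpace X]
    [TopologicalSpace Z] [T2Space Z] [MeasurableSpace Z] [OpensMeasurableSpace Z]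
    {K : Set X} (hK : IsCompact K) {g : X → Z} (hg : Continuous g) :
    ∃ s : Z → X, Measurable s ∧ ∀ z ∈ g '' K, g (s z) = z := by
  rcases K.eq_empty_or_nonempty with rfl | hne
  · exact ⟨fun _ => Classical.arbitrary X, measurable_const, by simp⟩
  let _ := TopologicalSpace.metrizableSpaceMetric X
  have : CompactSpace K := isCompact_iff_compactSpace.mp hK
  have : Nonempty K := hne.to_subtype
  have : CompactSpace cantorSet := isCompact_iff_compactSpace.mp isCompact_cantorSet
  obtain ⟨h, hcont, hsurj⟩ := exists_nat_bool_continuous_surjective_of_compact K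
  set q : cantorSet → X := fun c => h (cantorSetHomeomorphNatToBool c)
  have hq : Continuous q := by fun_prop
  have hp : Continuous (g ∘ q) := hg.comp hq
  have hrange : range (g ∘ q) = g '' K := by
    rw [range_comp]
    congr 1
    ext x
    constructor
    · rintro ⟨c, rfl⟩
      exact (h _).2
    · intro hx
      obtain ⟨b, hb⟩ := hsurj ⟨x, hx⟩
      exact ⟨cantorSetHomeomorphNatToBool.symm b, by simp [q, hb]⟩
  set T : Z → Set ℝ := fun z => Subtype.val '' ((g ∘ q) ⁻¹' {z})
  have hT (z : Z) : IsCompact (T z) :=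
    (isClosed_singleton.preimage hp).isCompact.image continuous_subtype_val
  have hTne {z : Z} (hz : z ∈ g '' K) : (T z).Nonempty := by
    rw [← hrange] at hz
    obtain ⟨c, hc⟩ := hz
    exact ⟨c, c, hc, rfl⟩
  have hTe {z : Z} (hz : z ∉ g '' K) : T z = ∅ := by
    rw [← hrange] at hz
    refine image_eq_empty.mpr (eq_empty_of_forall_notMem fun c hc => hz ⟨c, hc⟩)
  have hmeas : Measurable fun z => sInf (T z) := by
    refine measurable_of_Iic fun a => ?_
    have hB : MeasurableSet (g '' K) := (hK.image hg).measurableSet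
    have hD : MeasurableSet ((g ∘ q) '' {c | (c : ℝ) ≤ a}) :=
      ((isClosed_le continuous_subtype_val continuous_const).isCompact.image hp).measurableSet
    have heq : (fun z => sInf (T z)) ⁻¹' Iic a =
        (g ∘ q) '' {c | (c : ℝ) ≤ a} ∪ ((g '' K)ᶜ ∩ {_z | (0 : ℝ) ≤ a}) := by
      ext z
      by_cases hz : z ∈ g '' K
      · simp only [mem_preimage, mem_Iic, mem_union, mem_inter_iff, mem_compl_iff, hz,
          not_true_eq_false, false_and, or_false]
        constructor
        · intro hle
          obtain ⟨c, hc, hcs⟩ := (hT z).sInf_mem (hTne hz)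
          exact ⟨c, by simpa [hcs] using hle, hc⟩
        · rintro ⟨c, hc, hcz⟩
          exact (csInf_le (hT z).bddBelow ⟨c, hcz, rfl⟩).trans hc
      · have hz' : z ∉ (g ∘ q) '' {c | (c : ℝ) ≤ a} := fun hmem =>
          hz (hrange ▸ image_subset_range _ _ hmem)
        simp only [mem_preimage, mem_Iic, mem_union, hz', hTe hz, Real.sInf_empty, mem_inter_iff,
          mem_compl_iff, hz, not_false_eq_true, true_and, mem_ofPred_eq, false_or]
    rw [heq]
    exact hD.union (hB.compl.inter (MeasurableSet.const _))
  have hmem (z : Z) : sInf (T z) ∈ cantorSet := by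
    by_cases hz : z ∈ g '' K
    · obtain ⟨c, -, hcs⟩ := (hT z).sInf_mem (hTne hz)
      exact hcs ▸ c.2
    · simpa [hTe hz] using zero_mem_cantorSet
  refine ⟨fun z => q ⟨sInf (T z), hmem z⟩, hq.measurable.comp (hmeas.subtype_mk), fun z hz => ?_⟩
  obtain ⟨c, hc, hcs⟩ := (hT z).sInf_mem (hTne hz)
  obtain rfl : c = ⟨sInf (T z), hmem z⟩ := Subtype.ext hcs
  exact hc

/-- Inner approximation of the outer measure of a continuous image of the Baire space by images
of compact sets. -/
theorem exists_isCompact_le_measure_image {Z : Type*} [TopologicalSpace Z] [MeasurableSpace Z]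
    {μ : Measure Z} [μ.OuterRegular] {g : (ℕ → ℕ) → Z} (hg : Continuous g) {r : ℝ≥0∞}
    (hr : r < μ (range g)) : ∃ K : Set (ℕ → ℕ), IsCompact K ∧ r ≤ μ (g '' K) := by
  have step (n : ℕ) (S : {S : Set (ℕ → ℕ) // r < μ (g '' S)}) :
      ∃ k : ℕ, r < μ (g '' (S.1 ∩ {x | x n ≤ k})) := by
    have hmono : Monotone fun k : ℕ => g '' (S.1 ∩ {x | x n ≤ k}) := fun a b hab =>
      image_mono (inter_subset_inter_right _ fun x (hx : x n ≤ a) => hx.trans hab)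
    have hU : ⋃ k : ℕ, g '' (S.1 ∩ {x | x n ≤ k}) = g '' S.1 := by
      rw [← image_iUnion, ← inter_iUnion]
      congr 1
      exact inter_eq_left.mpr fun x _ => mem_iUnion.mpr ⟨x n, le_refl (x n)⟩
    have := S.2
    rw [← hU, hmono.measure_iUnion] at this
    exact lt_iSup_iff.mp this
  choose k hk using step
  let S : ℕ → {S : Set (ℕ → ℕ) // r < μ (g '' S)} := fun n =>
    Nat.rec ⟨univ, by rwa [image_univ]⟩ (fun n S => ⟨_, hk n S⟩) n
  have hS (n : ℕ) : (S (n + 1)).1 = (S n).1 ∩ {x | x n ≤ k n (S n)} := rfl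
  have hSle (n : ℕ) : ∀ x ∈ (S n).1, ∀ i < n, x i ≤ k i (S i) := by
    induction n with
    | zero => simp
    | succ n ih =>
      intro x hx i hi
      rw [hS] at hx
      rcases Nat.lt_succ_iff_lt_or_eq.mp hi with h | rfl
      · exact ih x hx.1 i h
      · exact hx.2
  set K : Set (ℕ → ℕ) := univ.pi fun i => Iic (k i (S i))
  have hK : IsCompact K := isCompact_univ_pi fun i => (finite_Iic _).isCompact
  refine ⟨K, hK, ?_⟩
  by_contra! hlt
  obtain ⟨U, hKU, hUo, hUr⟩ := (g '' K).exists_isOpen_lt_of_lt r hlt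
  have hx (n : ℕ) : ∃ x ∈ (S n).1, g x ∉ U := by
    by_contra! hsub
    exact (hUr.trans (S n).2).not_ge (measure_mono (image_subset_iff.mpr hsub))
  choose x hxS hxU using hx
  obtain ⟨y, hyK, φ, hφ, hlim⟩ := hK.tendsto_subseq
    (x := fun n i => min (x n i) (k i (S i))) fun n i _ => mem_Iic.mpr (min_le_right _ _)
  have hlim' : Filter.Tendsto (x ∘ φ) Filter.atTop (nhds y) := by
    rw [tendsto_pi_nhds] at hlim ⊢
    intro i
    refine (hlim i).congr' ?_
    filter_upwards [Filter.eventually_gt_atTop i] with n hn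
    exact min_eq_left (hSle _ _ (hxS _) i (hn.trans_le (hφ.id_le n)))
  exact hUo.isClosed_compl.mem_of_tendsto ((hg.tendsto y).comp hlim')
    (.of_forall fun n => hxU (φ n)) (hKU ⟨y, hyK, rfl⟩)

/-- A continuous map from the Baire space whose range has full measure has an almost everywhere
Borel right inverse. -/
theorem exists_measurable_ae_rightInverse {Z : Type*} [TopologicalSpace Z] [T2Space Z]
    [MeasurableSpace Z] [OpensMeasurableSpace Z] {μ : Measure Z} [IsProbabilityMeasure μ]
    [μ.OuterRegular] {g : (ℕ → ℕ) → Z} (hg : Continuous g) (hfull : ∀ᵐ z ∂μ, z ∈ range g) :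
    ∃ s : Z → ℕ → ℕ, Measurable s ∧ ∀ᵐ z ∂μ, g (s z) = z := by
  classical
  have hone : μ (range g) = 1 :=
    (measure_congr (Filter.eventuallyEq_univ.mpr hfull)).trans measure_univ
  obtain ⟨r, -, hr, hrlim⟩ := exists_seq_strictMono_tendsto' (zero_lt_one (α := ℝ≥0∞))
  choose K hK hrK using fun n =>
    exists_isCompact_le_measure_image (μ := μ) hg (r := r n) (by rw [hone]; exact (hr n).2)
  choose s hs hgs using fun n => (hK n).exists_measurable_rightInverse hg
  set B : Set Z := ⋃ n, g '' K n
  have hBn (n : ℕ) : MeasurableSet (g '' K n) := ((hK n).image hg).measurableSet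
  have hB : MeasurableSet B := .iUnion hBn
  have hBfull : μ B = 1 := le_antisymm prob_le_one <| le_of_tendsto' hrlim fun n =>
    (hrK n).trans (measure_mono (subset_iUnion (fun n => g '' K n) n))
  have hex (z : Z) : ∃ n, z ∈ g '' K n ∨ z ∉ B := by
    by_cases hz : z ∈ B
    · obtain ⟨n, hn⟩ := mem_iUnion.mp hz
      exact ⟨n, .inl hn⟩
    · exact ⟨0, .inr hz⟩
  refine ⟨fun z => s (Nat.find (hex z)) z,
    Measurable.find (p := fun n z => z ∈ g '' K n ∨ z ∉ B) hs
      (fun n => (hBn n).union hB.compl) hex, ?_⟩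
  filter_upwards [(mem_ae_iff_prob_eq_one hB).mpr hBfull] with z hz
  exact hgs _ z ((Nat.find_spec (hex z)).resolve_right (not_not.mpr hz))

/-- **Measurable selection**: a Borel set in a product of Polish spaces, almost all of whose
sections are nonempty, contains almost all of the graph of a Borel map. -/
theorem MeasurableSet.exists_measurable_ae_mem {U Z : Type*}
    [TopologicalSpace U] [PolishSpace U] [MeasurableSpace U] [BorelSpace U]
    [TopologicalSpace Z] [PolishSpace Z] [MeasurableSpace Z] [BorelSpace Z]
    {μ : Measure Z} [IsProbabilityMeasure μ] {A : Set (U × Z)} (hA : MeasurableSet A)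
    (hne : ∀ᵐ z ∂μ, ∃ u, (u, z) ∈ A) :
    ∃ s : Z → U, Measurable s ∧ ∀ᵐ z ∂μ, (s z, z) ∈ A := by
  have hAa := hA.analyticSet
  rw [AnalyticSet] at hAa
  rcases hAa with rfl | ⟨f, hf, rfl⟩
  · obtain ⟨z, u, hu⟩ := hne.exists
    exact hu.elim
  have hfull : ∀ᵐ z ∂μ, z ∈ range (Prod.snd ∘ f) := by
    filter_upwards [hne] with z ⟨u, x, hx⟩
    exact ⟨x, by simp [hx]⟩
  let _ := TopologicalSpace.metrizableSpaceMetric Z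
  obtain ⟨s, hs, hsz⟩ := exists_measurable_ae_rightInverse (continuous_snd.comp hf) hfull
  refine ⟨fun z => (f (s z)).1, (continuous_fst.comp hf).measurable.comp hs, ?_⟩
  filter_upwards [hsz] with z hz
  exact ⟨s z, Prod.ext rfl hz⟩

/-- The means of the moment function under the probability measures carried by the support
restriction that have `Z`-marginal `F`. -/
def attainableMeans {U Z : Type*} [MeasurableSpace U] [MeasurableSpace Z] {d : ℕ}
    (Γθ : Set (U × Z)) (rθ : U → Z → EuclideanSpace ℝ (Fin d)) (F : Measure Z) :
    Set (EuclideanSpace ℝ (Fin d)) :=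
  {v | ∃ H : Measure (U × Z), IsProbabilityMeasure H ∧ H Γθ = 1 ∧ H.map Prod.snd = F ∧
    Integrable (fun p : U × Z => rθ p.1 p.2) H ∧ (∫ p : U × Z, rθ p.1 p.2 ∂H) = v}

theorem convex_attainableMeans {U Z : Type*} [MeasurableSpace U] [MeasurableSpace Z] {d : ℕ}
    (Γθ : Set (U × Z)) (rθ : U → Z → EuclideanSpace ℝ (Fin d)) (F : Measure Z) :
    Convex ℝ (attainableMeans Γθ rθ F) := by
  rintro _ ⟨H, hH, hHΓ, hHF, hHi, rfl⟩ _ ⟨H', hH', hHΓ', hHF', hHi', rfl⟩ a b ha hb hab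
  have hab' : ENNReal.ofReal a + ENNReal.ofReal b = 1 := by
    rw [← ENNReal.ofReal_add ha hb, hab, ENNReal.ofReal_one]
  have hi := hHi.smul_measure (c := ENNReal.ofReal a) ENNReal.ofReal_ne_top
  have hi' := hHi'.smul_measure (c := ENNReal.ofReal b) ENNReal.ofReal_ne_top
  refine ⟨ENNReal.ofReal a • H + ENNReal.ofReal b • H', ⟨by simp [hab']⟩,
    by simp [hHΓ, hHΓ', hab'], ?_, hi.add_measure hi', ?_⟩
  · rw [Measure.map_add _ _ measurable_snd, Measure.map_smul, Measure.map_smul, hHF, hHF',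
      ← add_smul, hab', one_smul]
  · rw [integral_add_measure hi hi', integral_smul_measure, integral_smul_measure,
      ENNReal.toReal_ofReal ha, ENNReal.toReal_ofReal hb]

theorem aumannIntegral_subset_thickening_attainableMeans {d : ℕ} {F : Measure 𝓩}
    [IsProbabilityMeasure F] {Γθ : Set (𝓤 × 𝓩)} {rθ : 𝓤 → 𝓩 → EuclideanSpace ℝ (Fin d)}
    (hΓ : MeasurableSet Γθ) (hr : Measurable fun p : 𝓤 × 𝓩 => rθ p.1 p.2) {δ : ℝ} (hδ : 0 < δ) :
    AumannIntegral Γθ rθ F ⊆ Metric.thickening δ (attainableMeans Γθ rθ F) := by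
  rintro _ ⟨f, hf, hfi, hfmem, rfl⟩
  have hA : MeasurableSet (Γθ ∩ {p : 𝓤 × 𝓩 | dist (rθ p.1 p.2) (hf.mk f p.2) < δ / 2}) :=
    hΓ.inter (measurableSet_lt (hr.dist (hf.measurable_mk.comp measurable_snd)) measurable_const)
  obtain ⟨s, hs, hsA⟩ := hA.exists_measurable_ae_mem (μ := F) (by
    filter_upwards [hfmem, hf.ae_eq_mk] with z hz hzf
    obtain ⟨_, ⟨u, hu, rfl⟩, hdist⟩ := Metric.mem_closure_iff.mp hz (δ / 2) (half_pos hδ)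
    exact ⟨u, hu, by rw [mem_ofPred_eq, dist_comm, ← hzf]; exact hdist⟩)
  have hgraph : Measurable fun z => (s z, z) := hs.prodMk measurable_id
  have hclose : ∀ᵐ z ∂F, ‖rθ (s z) z - f z‖ ≤ δ / 2 := by
    filter_upwards [hsA, hf.ae_eq_mk] with z hz hzf
    rw [hzf, ← dist_eq_norm]
    exact hz.2.le
  have hrs : Measurable fun z => rθ (s z) z := hr.comp hgraph
  have hdiff : Integrable (fun z => rθ (s z) z - f z) F :=
    .of_bound (hrs.aestronglyMeasurable.sub hfi.aestronglyMeasurable) _ hclose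
  have hri : Integrable (fun z => rθ (s z) z) F := by
    simpa only [Pi.add_def, sub_add_cancel] using hdiff.add hfi
  refine Metric.mem_thickening_iff.mpr ⟨∫ z, rθ (s z) z ∂F,
    ⟨F.map fun z => (s z, z), Measure.isProbabilityMeasure_map hgraph.aemeasurable, ?_, ?_, ?_, ?_⟩,
    ?_⟩
  · rw [Measure.map_apply hgraph hΓ]
    exact (measure_congr <| Filter.eventuallyEq_univ.mpr <|
      hsA.mono fun z hz => hz.1).trans measure_univ
  · rw [Measure.map_map measurable_snd hgraph]
    exact Measure.map_id
  · exact (integrable_map_measure hr.aestronglyMeasurable hgraph.aemeasurable).mpr hri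
  · exact integral_map hgraph.aemeasurable hr.aestronglyMeasurable
  · rw [dist_comm, dist_eq_norm, ← integral_sub hri hfi]
    have := norm_integral_le_of_norm_le_const hclose
    simp only [probReal_univ, mul_one] at this
    linarith

/-- **Lemma B.4 (sufficient condition for membership in the moment closure via the Aumann
integral).**  Under Assumption 1, for any `F ∈ 𝓕` and `θ ∈ Θ`, if `0` belongs to the closure
of the convex hull of the Aumann integral `𝔼_I(θ,F)`, then `θ ∈ Θ̄_I(F)`. -/
theorem mem_moment_closure_of_aumann {d : ℕ}
    (𝓕 : Set (Measure 𝓩)) (hprob : ∀ F ∈ 𝓕, IsProbabilityMeasure F)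
    (Γ : Θ → Set (𝓤 × 𝓩)) (r : Θ → 𝓤 → 𝓩 → EuclideanSpace ℝ (Fin d))
    (h1 : Assumption1 𝓕 Γ r)
    (F : Measure 𝓩) (hF : F ∈ 𝓕) (θ : Θ)
    (h0 : (0 : EuclideanSpace ℝ (Fin d)) ∈
      closure (convexHull ℝ (AumannIntegral (Γ θ) (r θ) F))) :
    MemMomentClosure (Γ θ) (r θ) F := by
  intro ε hε
  have := hprob F hF
  have hA := h1 θ F hF
  have hsub := convexHull_min (aumannIntegral_subset_thickening_attainableMeans (F := F)
    hA.borel_Gamma hA.measurable_r (half_pos hε))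
    ((convex_attainableMeans (Γ θ) (r θ) F).thickening (ε / 2))
  obtain ⟨w, hw, hw0⟩ := Metric.mem_closure_iff.mp h0 (ε / 2) (half_pos hε)
  obtain ⟨v, ⟨H, hH, hHΓ, hHF, hHi, hHv⟩, hv⟩ := Metric.mem_thickening_iff.mp (hsub hw)
  refine ⟨H, hH, hHΓ, hHF, hHi, ?_⟩
  rw [hHv, ← dist_zero_left]
  linarith [dist_triangle 0 w v]

end
end

section
/- Stability of interior points of convex hulls under perturbation of finitely many generating points (Lemma C.3). Let A be a nonempty subset of ℝ^d and suppose x belongs to the interior of the convex hull of A. Then there exist ε > 0, a positive integer K, and points a₁, …, a_K ∈ A such that for all points a′₁, …, a′_K ∈ ℝ^d with ‖aᵢ − a′ᵢ‖ < ε for every i = 1, …, K, x belongs to the interior of the convex hull of {a′₁, …, a′_K}. -/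
noncomputable section

open Metric in
/-- If the convex hull of a finite family contains the closed ball of radius `2 * ε` around `x`,
then `x` stays in the interior of the convex hull when each point moves by less than `ε`. -/
theorem mem_interior_convexHull_range_of_norm_sub_lt {E ι : Type*} [NormedAddCommGroup E]
    [NormedSpace ℝ E] [Finite ι] {a a' : ι → E} {x : E} {ε : ℝ} (hε : 0 < ε)
    (hball : closedBall x (2 * ε) ⊆ convexHull ℝ (Set.range a))
    (ha' : ∀ i, ‖a i - a' i‖ < ε) : x ∈ interior (convexHull ℝ (Set.range a')) := by
  refine mem_interior.2 ⟨ball x ε, fun y hy => ?_, isOpen_ball, mem_ball_self hε⟩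
  by_contra hy'
  obtain ⟨f, u, hfu, huy⟩ := geometric_hahn_banach_closed_point (convex_convexHull ℝ _)
    ((Set.finite_range a').isClosed_convexHull ℝ) hy'
  have hhull : convexHull ℝ (Set.range a) ⊆ {z | f z ≤ u + ‖f‖ * ε} := by
    refine convexHull_min ?_ (convex_halfSpace_le f.toLinearMap.isLinear _)
    rintro _ ⟨i, rfl⟩
    have h₁ := hfu (a' i) (subset_convexHull ℝ _ ⟨i, rfl⟩)
    have h₂ : f (a i - a' i) ≤ ‖f‖ * ε := (le_abs_self _).trans (f.le_opNorm_of_le (ha' i).le)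
    rw [map_sub] at h₂
    change f (a i) ≤ u + ‖f‖ * ε
    linarith
  have hbound : ∀ w : E, ‖w‖ = 1 → ε * f w ≤ u - f y + ‖f‖ * ε := by
    intro w hw
    have hmem : y + ε • w ∈ closedBall x (2 * ε) := by
      rw [mem_ball_iff_norm] at hy
      rw [mem_closedBall_iff_norm, add_sub_right_comm]
      refine (norm_add_le _ _).trans ?_
      rw [norm_smul, hw, Real.norm_of_nonneg hε.le]
      linarith
    have h : f (y + ε • w) ≤ u + ‖f‖ * ε := hhull (hball hmem)
    rw [map_add, map_smul, smul_eq_mul] at h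
    linarith
  have hnonneg : 0 ≤ u - f y + ‖f‖ * ε := by
    have h : f y ≤ u + ‖f‖ * ε :=
      hhull (hball (ball_subset_closedBall (ball_subset_ball (by linarith) hy)))
    linarith
  have hnorm : ‖f‖ ≤ (u - f y + ‖f‖ * ε) / ε := by
    refine f.opNorm_le_of_unit_norm (by positivity) fun w hw => ?_
    rw [le_div_iff₀ hε, Real.norm_eq_abs, mul_comm, ← abs_of_pos hε, ← abs_mul, abs_of_pos hε]
    refine abs_le'.2 ⟨hbound w hw, ?_⟩
    have h := hbound (-w) (by rwa [norm_neg])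
    rwa [map_neg, mul_neg] at h
  rw [le_div_iff₀ hε] at hnorm
  linarith

/-- Finitely many points of a convex hull lie in the convex hull of finitely many generators. -/
theorem exists_finset_subset_convexHull_of_finite {E : Type*} [AddCommGroup E] [Module ℝ E]
    {s A : Set E} (hs : s.Finite) (hsA : s ⊆ convexHull ℝ A) :
    ∃ t : Finset E, ↑t ⊆ A ∧ s ⊆ convexHull ℝ (t : Set E) := by
  classical
  induction s, hs using Set.Finite.induction_on with
  | empty => exact ⟨∅, by simp, Set.empty_subset _⟩
  | @insert p s _ _ ih =>
    obtain ⟨hp, hsA⟩ := Set.insert_subset_iff.1 hsA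
    obtain ⟨t, htA, hst⟩ := ih hsA
    rw [convexHull_eq_union_convexHull_finite_subsets] at hp
    obtain ⟨t', ht'A, hpt'⟩ := Set.mem_iUnion₂.1 hp
    refine ⟨t' ∪ t, by simp [htA, ht'A], ?_⟩
    rw [Finset.coe_union]
    exact Set.insert_subset (convexHull_mono Set.subset_union_left hpt')
      (hst.trans (convexHull_mono Set.subset_union_right))

/-- **Lemma C.3 (stability of interior points of convex hulls under perturbation of finitely
many generating points).**  Let `A` be a nonempty subset of `ℝ^d` and suppose `x` belongs to
the interior of the convex hull of `A`.  Then there exist `ε > 0`, a positive integer `K`, and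
points `a₁, …, a_K ∈ A` such that for all `a′₁, …, a′_K` with `‖aᵢ − a′ᵢ‖ < ε` for every `i`,
`x` belongs to the interior of the convex hull of `{a′₁, …, a′_K}`. -/
theorem interior_convexHull_stable_under_perturbation {d : ℕ} (hd : 1 ≤ d)
    (A : Set (EuclideanSpace ℝ (Fin d))) (hne : A.Nonempty)
    (x : EuclideanSpace ℝ (Fin d)) (hx : x ∈ interior (convexHull ℝ A)) :
    ∃ ε : ℝ, 0 < ε ∧ ∃ K : ℕ, 0 < K ∧ ∃ a : Fin K → EuclideanSpace ℝ (Fin d),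
      (∀ i, a i ∈ A) ∧
      ∀ a' : Fin K → EuclideanSpace ℝ (Fin d), (∀ i, ‖a i - a' i‖ < ε) →
        x ∈ interior (convexHull ℝ (Set.range a')) := by
  obtain ⟨b, hxb, hbA⟩ := exists_mem_interior_convexHull_affineBasis
    (mem_interior_iff_mem_nhds.1 hx)
  obtain ⟨t, htA, hbt⟩ := exists_finset_subset_convexHull_of_finite (Set.finite_range b)
    ((subset_convexHull ℝ _).trans hbA)
  have hxt : x ∈ interior (convexHull ℝ (t : Set (EuclideanSpace ℝ (Fin d)))) :=
    interior_mono (convexHull_min hbt (convex_convexHull ℝ _)) hxb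
  obtain ⟨r, hr, hball⟩ := Metric.nhds_basis_closedBall.mem_iff.1
    (mem_interior_iff_mem_nhds.1 hxt)
  have htne : t.Nonempty := by
    simpa using convexHull_nonempty_iff.1 ⟨x, interior_subset hxt⟩
  have hrange : Set.range (fun i => (t.equivFin.symm i : EuclideanSpace ℝ (Fin d))) = t := by
    rw [Set.range_comp' Subtype.val, t.equivFin.symm.surjective.range_eq, Set.image_univ]
    exact Subtype.range_coe
  refine ⟨r / 2, half_pos hr, t.card, htne.card_pos, fun i => t.equivFin.symm i,
    fun i => htA (t.equivFin.symm i).2, fun a' ha' => ?_⟩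
  refine mem_interior_convexHull_range_of_norm_sub_lt (half_pos hr) ?_ ha'
  rwa [hrange, mul_div_cancel₀ r two_ne_zero]

end
end

section
/- Mixture identity for degenerate directions (intermediate claim in the proof of Theorem B.2). Suppose Assumption 1 holds and 𝓕 is convex. Fix θ ∈ Θ. For any F₁, F₂ ∈ 𝓕'_θ and any δ ∈ (0,1), with F_δ = δF₁ + (1−δ)F₂, one has Λ(F_δ) = Λ(F₁) ∩ Λ(F₂). -/
open MeasureTheory Set
open scoped ENNReal RealInnerProductSpace

noncomputable section

variable {𝓤 𝓩 : Type*}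
  [MeasurableSpace 𝓤] [TopologicalSpace 𝓤] [PolishSpace 𝓤] [BorelSpace 𝓤]
  [MeasurableSpace 𝓩] [TopologicalSpace 𝓩] [PolishSpace 𝓩] [BorelSpace 𝓩]
  {Θ : Type*}

/-- The set `𝓕'_θ` of distributions in `𝓕` satisfying all support-function inequalities
at `θ`. -/
def FPrimeSet {d : ℕ} (𝓕 : Set (Measure 𝓩)) (Γθ : Set (𝓤 × 𝓩))
    (rθ : 𝓤 → 𝓩 → EuclideanSpace ℝ (Fin d)) : Set (Measure 𝓩) :=
  {F ∈ 𝓕 | MemSFSet Γθ rθ F}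

/-- The set `Λ(F)` of degenerate directions: unit vectors `λ ∈ 𝒮₂` with
`∫ γ₂(λ,z;θ) dF = 0`. -/
def LambdaSet {d2 : ℕ} (Γθ : Set (𝓤 × 𝓩)) (r2θ : 𝓤 → 𝓩 → EuclideanSpace ℝ (Fin d2))
    (F : Measure 𝓩) : Set (EuclideanSpace ℝ (Fin d2)) :=
  {l | ‖l‖ = 1 ∧ integralEReal F (suppFun2 Γθ r2θ l) = 0}

theorem inner_append_zero_rComb {α β : Type*} {d1 d2 : ℕ} (r1θ : β → EuclideanSpace ℝ (Fin d1))
    (r2θ : α → β → EuclideanSpace ℝ (Fin d2)) (l : EuclideanSpace ℝ (Fin d2)) (u : α) (z : β) :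
    ⟪(WithLp.toLp 2 (Fin.append (0 : Fin d1 → ℝ) l) : EuclideanSpace ℝ (Fin (d1 + d2))),
      rComb r1θ r2θ u z⟫ = ⟪l, r2θ u z⟫ := by
  simp [rComb, PiLp.inner_apply, Fin.sum_univ_add]

theorem norm_append_zero {d1 d2 : ℕ} (l : EuclideanSpace ℝ (Fin d2)) :
    ‖(WithLp.toLp 2 (Fin.append (0 : Fin d1 → ℝ) l) : EuclideanSpace ℝ (Fin (d1 + d2)))‖ =
      ‖l‖ := by
  simp [EuclideanSpace.norm_eq, Fin.sum_univ_add]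

theorem suppFun_append_zero {α β : Type*} {d1 d2 : ℕ} (Γθ : Set (α × β))
    (r1θ : β → EuclideanSpace ℝ (Fin d1)) (r2θ : α → β → EuclideanSpace ℝ (Fin d2))
    (l : EuclideanSpace ℝ (Fin d2)) :
    suppFun Γθ (rComb r1θ r2θ) (WithLp.toLp 2 (Fin.append (0 : Fin d1 → ℝ) l)) =
      suppFun2 Γθ r2θ l := by
  funext z
  simp only [suppFun, suppFun2, momentSet, Set.image_image, inner_append_zero_rComb]

theorem MemSFSet.integralEReal_suppFun2_nonneg {α β : Type*} [MeasurableSpace β] {d1 d2 : ℕ}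
    {Γθ : Set (α × β)}
    {r1θ : β → EuclideanSpace ℝ (Fin d1)} {r2θ : α → β → EuclideanSpace ℝ (Fin d2)}
    {F : Measure β} (h : MemSFSet Γθ (rComb r1θ r2θ) F) {l : EuclideanSpace ℝ (Fin d2)}
    (hl : ‖l‖ = 1) : 0 ≤ integralEReal F (suppFun2 Γθ r2θ l) := by
  rw [← suppFun_append_zero Γθ r1θ r2θ l]
  exact h _ ((norm_append_zero l).trans hl)

theorem EReal.coe_ennreal_sub_nonneg_iff {p n : ℝ≥0∞} :
    (0 : EReal) ≤ (p : EReal) - (n : EReal) ↔ n ≤ p ∧ n ≠ ⊤ := by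
  induction n with
  | top => simp
  | coe n =>
    rw [EReal.sub_nonneg (Or.inr (by simp)) (Or.inr (by simp))]
    simp

theorem EReal.coe_ennreal_sub_eq_zero_iff {p n : ℝ≥0∞} :
    (p : EReal) - (n : EReal) = 0 ↔ p = n ∧ n ≠ ⊤ := by
  constructor
  · intro h
    obtain ⟨hle, hn⟩ := EReal.coe_ennreal_sub_nonneg_iff.1 h.ge
    refine ⟨le_antisymm ?_ hle, hn⟩
    have h' := (EReal.sub_nonpos).1 h.le
    exact EReal.coe_ennreal_le_coe_ennreal_iff.1 h'
  · rintro ⟨rfl, hn⟩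
    exact EReal.sub_self (by simpa using hn) (by simp)

/-- Extended integrals that are both nonnegative vanish against a strict positive combination of
the measures iff each of them vanishes. No measurability of the integrand is needed. -/
theorem integralEReal_smul_add_smul_eq_zero_iff {α : Type*} [MeasurableSpace α]
    {F₁ F₂ : Measure α} {f : α → EReal} {a b : ℝ≥0∞} (ha : a ≠ 0) (ha' : a ≠ ⊤) (hb : b ≠ 0)
    (hb' : b ≠ ⊤) (h₁ : 0 ≤ integralEReal F₁ f) (h₂ : 0 ≤ integralEReal F₂ f) :
    integralEReal (a • F₁ + b • F₂) f = 0 ↔ integralEReal F₁ f = 0 ∧ integralEReal F₂ f = 0 := by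
  simp only [integralEReal, lintegral_add_measure, lintegral_smul_measure, smul_eq_mul,
    EReal.coe_ennreal_sub_eq_zero_iff, EReal.coe_ennreal_sub_nonneg_iff] at h₁ h₂ ⊢
  obtain ⟨hle₁, hn₁⟩ := h₁
  obtain ⟨hle₂, hn₂⟩ := h₂
  have hA := ENNReal.mul_ne_top ha' hn₁
  have hB := ENNReal.mul_ne_top hb' hn₂
  have hleA := mul_le_mul_right hle₁ a
  have hleB := mul_le_mul_right hle₂ b
  constructor
  · rintro ⟨h, -⟩
    refine ⟨⟨le_antisymm ?_ hle₁, hn₁⟩, ⟨le_antisymm ?_ hle₂, hn₂⟩⟩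
    · rw [← ENNReal.mul_le_mul_iff_right ha ha']
      exact ENNReal.le_of_add_le_add_right hB ((add_le_add_right hleB _).trans h.le)
    · rw [← ENNReal.mul_le_mul_iff_right hb hb']
      exact ENNReal.le_of_add_le_add_left hA ((add_le_add_left hleA _).trans h.le)
  · rintro ⟨⟨e₁, -⟩, ⟨e₂, -⟩⟩
    exact ⟨by rw [e₁, e₂], ENNReal.add_ne_top.2 ⟨hA, hB⟩⟩

/-- **Mixture identity for degenerate directions** (intermediate claim in the proof of
Theorem B.2).  Suppose Assumption 1 holds and `𝓕` is convex.  Fix `θ ∈ Θ`.  For any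
`F₁, F₂ ∈ 𝓕'_θ` and any `δ ∈ (0,1)`, with `F_δ = δF₁ + (1−δ)F₂`, one has
`Λ(F_δ) = Λ(F₁) ∩ Λ(F₂)`. -/
theorem lambdaSet_mixture {d1 d2 : ℕ}
    (𝓕 : Set (Measure 𝓩)) (hprob : ∀ F ∈ 𝓕, IsProbabilityMeasure F)
    (hconv : ConvexFamily 𝓕)
    (Γ : Θ → Set (𝓤 × 𝓩)) (r1 : Θ → 𝓩 → EuclideanSpace ℝ (Fin d1))
    (r2 : Θ → 𝓤 → 𝓩 → EuclideanSpace ℝ (Fin d2))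
    (h1 : Assumption1 𝓕 Γ (fun θ => rComb (r1 θ) (r2 θ)))
    (θ : Θ) (F₁ F₂ : Measure 𝓩)
    (hF₁ : F₁ ∈ FPrimeSet 𝓕 (Γ θ) (rComb (r1 θ) (r2 θ)))
    (hF₂ : F₂ ∈ FPrimeSet 𝓕 (Γ θ) (rComb (r1 θ) (r2 θ)))
    (δ : ℝ) (hδ0 : 0 < δ) (hδ1 : δ < 1) :
    LambdaSet (Γ θ) (r2 θ) (ENNReal.ofReal δ • F₁ + ENNReal.ofReal (1 - δ) • F₂) =
      LambdaSet (Γ θ) (r2 θ) F₁ ∩ LambdaSet (Γ θ) (r2 θ) F₂ := by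
  have hδ : ENNReal.ofReal δ ≠ 0 := by simpa using hδ0
  have hδ' : ENNReal.ofReal (1 - δ) ≠ 0 := by simpa using hδ1
  ext l
  simp only [LambdaSet, Set.mem_inter_iff, Set.mem_ofPred_eq, ← and_and_left]
  refine and_congr_right fun hl => ?_
  exact integralEReal_smul_add_smul_eq_zero_iff hδ ENNReal.ofReal_ne_top hδ' ENNReal.ofReal_ne_top
    (hF₁.2.integralEReal_suppFun2_nonneg hl) (hF₂.2.integralEReal_suppFun2_nonneg hl)

end
end

section
/- Degenerate directions and the relative interior (intermediate claims in the proof of Theorem B.2). Suppose Assumption 1 holds and 𝓕 is convex. Fix θ ∈ Θ. Then: (a) for any F₁, F₂ ∈ ri 𝓕'_θ, Λ(F₁) = Λ(F₂); and (b) if, in addition, 𝓕'_θ contains at least two elements and for every F ∈ 𝓕'_θ there exists F′ ∈ 𝓕'_θ with F′ ≠ F such that ½F + ½F′ ∈ ri 𝓕'_θ, then for every F* ∈ ri 𝓕'_θ one has ⋂_{F ∈ 𝓕'_θ} Λ(F) = Λ(F*). -/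
open MeasureTheory Set
open scoped ENNReal RealInnerProductSpace

noncomputable section

variable {𝓤 𝓩 : Type*}
  [MeasurableSpace 𝓤] [TopologicalSpace 𝓤] [PolishSpace 𝓤] [BorelSpace 𝓤]
  [MeasurableSpace 𝓩] [TopologicalSpace 𝓩] [PolishSpace 𝓩] [BorelSpace 𝓩]
  {Θ : Type*}

/-- The relative interior of `𝓕'_θ`:
`ri 𝓕'_θ = {F ∈ 𝓕'_θ : ∀ F′ ∈ 𝓕'_θ, ∃ δ > 1, δF + (1−δ)F′ ∈ 𝓕'_θ}`, where the (possibly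
signed) combination `δF + (1−δ)F′ = G` is encoded via the measure identity
`δ • F = G + (δ−1) • F′`. -/
def riSet (𝓕' : Set (Measure 𝓩)) : Set (Measure 𝓩) :=
  {F ∈ 𝓕' | ∀ F' ∈ 𝓕', ∃ δ : ℝ, 1 < δ ∧ ∃ G ∈ 𝓕',
    ENNReal.ofReal δ • F = G + ENNReal.ofReal (δ - 1) • F'}

theorem EReal.posPart_le_ofReal {x : EReal} {c : ℝ} (h : x ≤ (c : EReal)) :
    x.posPart ≤ ENNReal.ofReal c := by
  induction x with
  | bot => simp [EReal.posPart]
  | top => simp at h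
  | coe x =>
    simpa [EReal.posPart] using ENNReal.ofReal_le_ofReal (EReal.coe_le_coe_iff.1 h)

theorem EReal.zero_le_coe_ennreal_sub {p n : ℝ≥0∞} (hn : n ≠ ⊤) :
    (0 : EReal) ≤ (p : EReal) - (n : EReal) ↔ n ≤ p := by
  rw [EReal.sub_nonneg (.inr (by simpa using hn)) (.inr (EReal.coe_ennreal_ne_bot n)),
    EReal.coe_ennreal_le_coe_ennreal_iff]

theorem EReal.coe_ennreal_sub_eq_zero {p n : ℝ≥0∞} (hn : n ≠ ⊤) :
    (p : EReal) - (n : EReal) = 0 ↔ p = n := by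
  lift n to NNReal using hn
  induction p with
  | top => simp
  | coe p =>
    have : ((p : ℝ≥0∞) : EReal) - ((n : ℝ≥0∞) : EReal) = ((p - n : ℝ) : EReal) := rfl
    rw [this, ENNReal.coe_inj, EReal.coe_eq_zero, sub_eq_zero, NNReal.coe_inj]

/-- The negative part of the support function in a unit direction has finite integral. -/
theorem lintegral_posPart_neg_suppFun_ne_top {U Z : Type*} [MeasurableSpace U]
    [MeasurableSpace Z] {d : ℕ} {F : Measure Z} {Γθ : Set (U × Z)}
    {rθ : U → Z → EuclideanSpace ℝ (Fin d)} (h : Assumption1At F Γθ rθ)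
    {l : EuclideanSpace ℝ (Fin d)} (hl : ‖l‖ = 1) :
    ∫⁻ z, (-(suppFun Γθ rθ l z)).posPart ∂F ≠ ⊤ := by
  obtain ⟨g, -, hg, hle⟩ := h.lower_envelope
  refine ne_top_of_le_ne_top hg.lintegral_lt_top.ne (lintegral_mono_ae ?_)
  filter_upwards [hle] with z hz
  apply EReal.posPart_le_ofReal
  have key : ∀ t ∈ momentSet Γθ rθ z, ((-‖t‖ : ℝ) : EReal) ≤ suppFun Γθ rθ l z := fun t ht => by
    refine le_trans (EReal.coe_le_coe_iff.2 ?_) (le_sSup (mem_image_of_mem _ ht))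
    simpa [hl] using neg_le_of_abs_le (abs_real_inner_le_norm l t)
  have hne : (momentSet Γθ rθ z).Nonempty := (h.nonempty_section z).image _
  generalize suppFun Γθ rθ l z = s at key
  induction s with
  | bot =>
    obtain ⟨t, ht⟩ := hne
    simpa only [le_bot_iff, EReal.coe_ne_bot] using key t ht
  | top => simp
  | coe s =>
    rw [← EReal.coe_neg, EReal.coe_le_coe_iff]
    refine le_trans (le_csInf (hne.image _) ?_) hz
    rintro _ ⟨t, ht, rfl⟩
    exact neg_le.1 (EReal.coe_le_coe_iff.1 (key t ht))

theorem exists_suppFun_rComb_eq_suppFun2 {U Z : Type*} {d1 d2 : ℕ} (Γθ : Set (U × Z))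
    (r1θ : Z → EuclideanSpace ℝ (Fin d1)) (r2θ : U → Z → EuclideanSpace ℝ (Fin d2))
    {l : EuclideanSpace ℝ (Fin d2)} (hl : ‖l‖ = 1) :
    ∃ l' : EuclideanSpace ℝ (Fin (d1 + d2)), ‖l'‖ = 1 ∧
      suppFun Γθ (rComb r1θ r2θ) l' = suppFun2 Γθ r2θ l := by
  refine ⟨WithLp.toLp 2 (Fin.append 0 l), ?_, ?_⟩
  · rw [← hl]
    simp [EuclideanSpace.norm_eq, Fin.sum_univ_add]
  · funext z
    rw [suppFun, suppFun2, momentSet, image_image]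
    congr 1
    refine image_congr fun u _ => ?_
    simp [rComb, PiLp.inner_apply, Fin.sum_univ_add]

/-- Equality in an aggregate of the inequalities `n ≤ p` forces equality in each of them. -/
theorem ENNReal.eq_of_mul_eq_add_mul {a b p pG p' nG n' : ℝ≥0∞} (ha : a ≠ ⊤)
    (hb : b ≠ 0) (hb' : b ≠ ⊤) (hp : p ≠ ⊤) (hG : nG ≤ pG) (h' : n' ≤ p')
    (hP : a * p = pG + b * p') (hN : a * p = nG + b * n') : p' = n' := by
  have hfin : nG + b * n' ≠ ⊤ := hN ▸ ENNReal.mul_ne_top ha hp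
  refine le_antisymm ?_ h'
  have h : nG + b * p' ≤ nG + b * n' := by
    rw [← hN, hP]
    gcongr
  have h := (ENNReal.add_le_add_iff_left (ENNReal.add_ne_top.1 hfin).1).1 h
  exact (ENNReal.mul_le_mul_iff_right hb hb').1 h

/-- A direction degenerate at a relative interior point of `𝓕'_θ` is degenerate on all of
`𝓕'_θ`. -/
theorem LambdaSet_subset_of_mem_riSet {U Z : Type*} [MeasurableSpace U] [MeasurableSpace Z]
    {d1 d2 : ℕ} {𝓕 : Set (Measure Z)} {Γθ : Set (U × Z)}
    {r1θ : Z → EuclideanSpace ℝ (Fin d1)} {r2θ : U → Z → EuclideanSpace ℝ (Fin d2)}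
    (h1 : ∀ F ∈ 𝓕, Assumption1At F Γθ (rComb r1θ r2θ)) {F₀ F : Measure Z}
    (hF₀ : F₀ ∈ riSet (FPrimeSet 𝓕 Γθ (rComb r1θ r2θ)))
    (hF : F ∈ FPrimeSet 𝓕 Γθ (rComb r1θ r2θ)) :
    LambdaSet Γθ r2θ F₀ ⊆ LambdaSet Γθ r2θ F := by
  rintro l ⟨hl, hl0⟩
  refine ⟨hl, ?_⟩
  obtain ⟨l', hl', heq⟩ := exists_suppFun_rComb_eq_suppFun2 Γθ r1θ r2θ hl
  rw [← heq] at hl0 ⊢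
  obtain ⟨hF₀', hri⟩ := hF₀
  obtain ⟨δ, hδ, G, hG, hmeas⟩ := hri F hF
  have hfin : ∀ H ∈ FPrimeSet 𝓕 Γθ (rComb r1θ r2θ),
      ∫⁻ z, (-(suppFun Γθ (rComb r1θ r2θ) l' z)).posPart ∂H ≠ ⊤ := fun H hH =>
    lintegral_posPart_neg_suppFun_ne_top (h1 H hH.1) hl'
  have hle : ∀ H ∈ FPrimeSet 𝓕 Γθ (rComb r1θ r2θ),
      ∫⁻ z, (-(suppFun Γθ (rComb r1θ r2θ) l' z)).posPart ∂H ≤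
        ∫⁻ z, (suppFun Γθ (rComb r1θ r2θ) l' z).posPart ∂H := fun H hH =>
    (EReal.zero_le_coe_ennreal_sub (hfin H hH)).1 (hH.2 l' hl')
  have hlint : ∀ f : Z → ℝ≥0∞, ENNReal.ofReal δ * ∫⁻ z, f z ∂F₀ =
      ∫⁻ z, f z ∂G + ENNReal.ofReal (δ - 1) * ∫⁻ z, f z ∂F := fun f => by
    simpa only [lintegral_add_measure, lintegral_smul_measure, smul_eq_mul] using
      congrArg (fun μ => ∫⁻ z, f z ∂μ) hmeas
  have h0 := (EReal.coe_ennreal_sub_eq_zero (hfin F₀ hF₀')).1 hl0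
  refine (EReal.coe_ennreal_sub_eq_zero (hfin F hF)).2 ?_
  refine ENNReal.eq_of_mul_eq_add_mul ENNReal.ofReal_ne_top
    (ENNReal.ofReal_pos.2 (sub_pos.2 hδ)).ne' ENNReal.ofReal_ne_top (h0 ▸ hfin F₀ hF₀')
    (hle G hG) (hle F hF) (hlint _) ?_
  rw [h0]
  exact hlint _

/-- **Degenerate directions and the relative interior** (intermediate claims in the proof of
Theorem B.2).  Suppose Assumption 1 holds and `𝓕` is convex.  Fix `θ ∈ Θ`.  Then:
(a) for any `F₁, F₂ ∈ ri 𝓕'_θ`, `Λ(F₁) = Λ(F₂)`; and (b) if moreover `𝓕'_θ` contains at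
least two elements and for every `F ∈ 𝓕'_θ` there is `F′ ∈ 𝓕'_θ` with `F′ ≠ F` such that
`½F + ½F′ ∈ ri 𝓕'_θ`, then for every `F* ∈ ri 𝓕'_θ`,
`⋂_{F ∈ 𝓕'_θ} Λ(F) = Λ(F*)`. -/
theorem lambdaSet_relative_interior {d1 d2 : ℕ}
    (𝓕 : Set (Measure 𝓩)) (hprob : ∀ F ∈ 𝓕, IsProbabilityMeasure F)
    (hconv : ConvexFamily 𝓕)
    (Γ : Θ → Set (𝓤 × 𝓩)) (r1 : Θ → 𝓩 → EuclideanSpace ℝ (Fin d1))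
    (r2 : Θ → 𝓤 → 𝓩 → EuclideanSpace ℝ (Fin d2))
    (h1 : Assumption1 𝓕 Γ (fun θ => rComb (r1 θ) (r2 θ)))
    (θ : Θ) :
    (∀ F₁ ∈ riSet (FPrimeSet 𝓕 (Γ θ) (rComb (r1 θ) (r2 θ))),
      ∀ F₂ ∈ riSet (FPrimeSet 𝓕 (Γ θ) (rComb (r1 θ) (r2 θ))),
        LambdaSet (Γ θ) (r2 θ) F₁ = LambdaSet (Γ θ) (r2 θ) F₂) ∧
    ((∃ F₁ ∈ FPrimeSet 𝓕 (Γ θ) (rComb (r1 θ) (r2 θ)),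
        ∃ F₂ ∈ FPrimeSet 𝓕 (Γ θ) (rComb (r1 θ) (r2 θ)), F₁ ≠ F₂) →
      (∀ F ∈ FPrimeSet 𝓕 (Γ θ) (rComb (r1 θ) (r2 θ)),
        ∃ F' ∈ FPrimeSet 𝓕 (Γ θ) (rComb (r1 θ) (r2 θ)), F' ≠ F ∧
          (ENNReal.ofReal (1/2 : ℝ) • F + ENNReal.ofReal (1/2 : ℝ) • F') ∈
            riSet (FPrimeSet 𝓕 (Γ θ) (rComb (r1 θ) (r2 θ)))) →
      ∀ Fstar ∈ riSet (FPrimeSet 𝓕 (Γ θ) (rComb (r1 θ) (r2 θ))),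
        (⋂ F ∈ FPrimeSet 𝓕 (Γ θ) (rComb (r1 θ) (r2 θ)), LambdaSet (Γ θ) (r2 θ) F) =
          LambdaSet (Γ θ) (r2 θ) Fstar) := by
  have h := fun F₀ hF₀ F hF => LambdaSet_subset_of_mem_riSet (F₀ := F₀) (F := F) (h1 θ) hF₀ hF
  refine ⟨fun F₁ hF₁ F₂ hF₂ => (h F₁ hF₁ F₂ hF₂.1).antisymm (h F₂ hF₂ F₁ hF₁.1),
    fun _ _ Fstar hFstar => ?_⟩
  exact (biInter_subset_of_mem hFstar.1).antisymm (subset_iInter₂ (h Fstar hFstar))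

end
end

section
/- Degenerate support function in the reformulated interval-regression model (claim proved in Example 3). Fix θ = (α, β) ∈ ℝ². For z = (y̲, ȳ, w) ∈ ℝ³ with y̲ ≤ ȳ and λ = (λ₁, λ₂, λ₃) ∈ ℝ³, define γ†(λ, z; θ) = sup_{u ∈ ℝ} [ (λ₁ + λ₂w)(u − α − βw) + λ₃(𝟙{y̲ ≤ u ≤ ȳ} − 1) ] ∈ ℝ ∪ {+∞}. Then γ†(λ, z; θ) = +∞ if λ₁ + λ₂w ≠ 0, and γ†(λ, z; θ) = max{0, −λ₃} if λ₁ + λ₂w = 0. In particular γ†(λ, z; θ) ≥ 0 for all such λ and z, so for every Borel probability measure F on ℝ³ with F(y̲ ≤ ȳ) = 1, the support-function inequalities ∫ γ†(λ, z; θ) dF ≥ 0 hold for every unit vector λ ∈ ℝ³ and every θ ∈ ℝ²; that is, the support-function set of the reformulated model equals the whole parameter space. -/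
open MeasureTheory
open scoped ENNReal RealInnerProductSpace

noncomputable section

/-- The moment function of the reformulated interval-censored regression model:
`r†(u, z; θ) = (u − α − βw, w(u − α − βw), 𝟙{y̲ ≤ u ≤ ȳ} − 1)` with `z = (y̲, ȳ, w)` and
`θ = (α, β)`; the support restriction is trivial. -/
def rDagger (θ : ℝ × ℝ) (u : ℝ) (z : ℝ × ℝ × ℝ) : EuclideanSpace ℝ (Fin 3) :=
  (EuclideanSpace.equiv (Fin 3) ℝ).symm
    ![u - θ.1 - θ.2 * z.2.2, z.2.2 * (u - θ.1 - θ.2 * z.2.2),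
      (if z.1 ≤ u ∧ u ≤ z.2.1 then (1 : ℝ) else 0) - 1]

/-- The support function of the reformulated model:
`γ†(λ, z; θ) = sup_{u ∈ ℝ} λᵀ r†(u, z; θ)`, valued in `ℝ ∪ {+∞}`. -/
def gammaDagger (l : EuclideanSpace ℝ (Fin 3)) (z : ℝ × ℝ × ℝ) (θ : ℝ × ℝ) : EReal :=
  ⨆ u : ℝ, ((⟪l, rDagger θ u z⟫ : ℝ) : EReal)

theorem inner_rDagger (l : EuclideanSpace ℝ (Fin 3)) (θ : ℝ × ℝ) (u : ℝ) (z : ℝ × ℝ × ℝ) :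
    ⟪l, rDagger θ u z⟫ = (l 0 + l 1 * z.2.2) * (u - θ.1 - θ.2 * z.2.2) +
      l 2 * ((if z.1 ≤ u ∧ u ≤ z.2.1 then (1 : ℝ) else 0) - 1) := by
  simp only [rDagger, PiLp.inner_apply, Fin.sum_univ_three, RCLike.inner_apply, conj_trivial,
    PiLp.coe_symm_continuousLinearEquiv, Matrix.cons_val_zero, Matrix.cons_val_one,
    Matrix.cons_val]
  ring

theorem gammaDagger_eq_top {l : EuclideanSpace ℝ (Fin 3)} {z : ℝ × ℝ × ℝ} (θ : ℝ × ℝ)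
    (h : l 0 + l 1 * z.2.2 ≠ 0) : gammaDagger l z θ = ⊤ := by
  rw [EReal.eq_top_iff_forall_lt]
  intro y
  refine lt_of_lt_of_le ?_ (le_iSup _
    (θ.1 + θ.2 * z.2.2 + (y + |l 2| + 1) / (l 0 + l 1 * z.2.2)))
  rw [EReal.coe_lt_coe_iff, inner_rDagger]
  have key : ∀ c x : ℝ, c ≠ 0 →
      c * (θ.1 + θ.2 * z.2.2 + x / c - θ.1 - θ.2 * z.2.2) = x := by
    intro c x hc
    field_simp
    ring
  rw [key _ _ h]
  have h₁ := le_abs_self (l 2)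
  have h₂ := abs_nonneg (l 2)
  split_ifs <;> linarith

theorem gammaDagger_eq_max {l : EuclideanSpace ℝ (Fin 3)} {z : ℝ × ℝ × ℝ} (θ : ℝ × ℝ)
    (hz : z.1 ≤ z.2.1) (h : l 0 + l 1 * z.2.2 = 0) :
    gammaDagger l z θ = ((max 0 (-(l 2)) : ℝ) : EReal) := by
  simp only [gammaDagger, inner_rDagger, h, zero_mul, zero_add]
  apply le_antisymm
  · refine iSup_le fun u => EReal.coe_le_coe_iff.2 ?_
    split_ifs <;> simp
  · rcases max_choice 0 (-(l 2)) with hm | hm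
    · rw [hm]
      refine le_iSup_of_le z.1 (EReal.coe_le_coe_iff.2 ?_)
      simp [hz]
    · rw [hm]
      refine le_iSup_of_le (z.2.1 + 1) (EReal.coe_le_coe_iff.2 ?_)
      rw [if_neg fun hu => by linarith [hu.2]]
      simp

theorem gammaDagger_nonneg (l : EuclideanSpace ℝ (Fin 3)) {z : ℝ × ℝ × ℝ} (θ : ℝ × ℝ)
    (hz : z.1 ≤ z.2.1) : 0 ≤ gammaDagger l z θ := by
  by_cases h : l 0 + l 1 * z.2.2 = 0
  · rw [gammaDagger_eq_max θ hz h]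
    exact EReal.coe_nonneg.2 (le_max_left _ _)
  · rw [gammaDagger_eq_top θ h]
    exact le_top

theorem EReal.posPart_neg_of_nonneg {x : EReal} (hx : 0 ≤ x) : (-x).posPart = 0 := by
  have hneg : -x ≤ 0 := EReal.neg_le_zero.2 hx
  rw [EReal.posPart, if_neg (ne_top_of_le_ne_top EReal.zero_ne_top hneg)]
  exact ENNReal.ofReal_of_nonpos (EReal.toReal_nonpos hneg)

theorem integralEReal_nonneg_of_ae {𝓩 : Type*} [MeasurableSpace 𝓩] {F : Measure 𝓩}
    {f : 𝓩 → EReal} (hf : ∀ᵐ z ∂F, 0 ≤ f z) : 0 ≤ integralEReal F f := by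
  have h : ∫⁻ z, (-(f z)).posPart ∂F = 0 :=
    (lintegral_congr_ae (hf.mono fun _ hz => EReal.posPart_neg_of_nonneg hz)).trans lintegral_zero
  rw [integralEReal, h, EReal.coe_ennreal_zero, sub_zero]
  exact EReal.coe_ennreal_nonneg _

/-- **Degenerate support function in the reformulated interval-regression model**
(claim proved in Example 3).  For `z = (y̲, ȳ, w)` with `y̲ ≤ ȳ`:
`γ†(λ, z; θ) = +∞` if `λ₁ + λ₂ w ≠ 0`, and `γ†(λ, z; θ) = max {0, −λ₃}` if
`λ₁ + λ₂ w = 0`.  In particular `γ†(λ, z; θ) ≥ 0` always, so for every Borel probability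
measure `F` on `ℝ³` with `F(y̲ ≤ ȳ) = 1` the support-function inequalities
`∫ γ†(λ, z; θ) dF ≥ 0` hold for every unit vector `λ` and every `θ`; that is, the
support-function set of the reformulated model is the whole parameter space `ℝ²`. -/
theorem gammaDagger_degenerate :
    (∀ (θ : ℝ × ℝ) (z : ℝ × ℝ × ℝ), z.1 ≤ z.2.1 → ∀ l : EuclideanSpace ℝ (Fin 3),
      (l 0 + l 1 * z.2.2 ≠ 0 → gammaDagger l z θ = ⊤) ∧
      (l 0 + l 1 * z.2.2 = 0 → gammaDagger l z θ = ((max 0 (-(l 2)) : ℝ) : EReal)) ∧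
      (0 : EReal) ≤ gammaDagger l z θ) ∧
    ∀ F : Measure (ℝ × ℝ × ℝ), IsProbabilityMeasure F →
      F {z : ℝ × ℝ × ℝ | z.1 ≤ z.2.1} = 1 →
      {θ : ℝ × ℝ | ∀ l : EuclideanSpace ℝ (Fin 3), ‖l‖ = 1 →
        (0 : EReal) ≤ integralEReal F (fun z => gammaDagger l z θ)} = Set.univ := by
  refine ⟨fun θ z hz l => ⟨gammaDagger_eq_top θ, gammaDagger_eq_max θ hz,
    gammaDagger_nonneg l θ hz⟩, fun F _ hF => ?_⟩
  have hae : ∀ᵐ z ∂F, z.1 ≤ z.2.1 :=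
    (mem_ae_iff_prob_eq_one (measurableSet_le measurable_fst measurable_snd.fst)).2 hF
  exact Set.eq_univ_of_forall fun θ l _ =>
    integralEReal_nonneg_of_ae (hae.mono fun _ hz => gammaDagger_nonneg l θ hz)

end
end
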